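/- Let A be a commutative noetherian ring of Krull dimension d (or any commutative ring of stable range dimension d) with d ≤ 2n-5. Then the image of Row_1: Um_{2,n}(A)/E_n(A) → Um_n(A)/E_n(A) is a subgroup of the group Um_n(A)/E_n(A). In particular, if the kernels of the unimodular rows v and w (as projective modules) each have a free direct summand and n = d+1, then so does the kernel of any row representing the product class wms(v)·wms(w). -/

import Mathlib

open Matrix

/-- A row is unimodular if its entries generate the unit ideal. -/
def Unim {A : Type*} [CommRing A] {ι : Type*} (v : ι → A) : Prop :=
  Ideal.span (Set.range v) = ⊤

/-- Elementary matrices: the multiplicative closure of the set of transvections. -/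
def ElemMats (ι : Type*) (A : Type*) [Fintype ι] [DecidableEq ι] [CommRing A] :
    Submonoid (Matrix ι ι A) :=
  Submonoid.closure {M | ∃ i j c, i ≠ j ∧ M = Matrix.transvection i j c}

namespace ElemRows

set_option linter.unusedSectionVars false

section Basic
variable {A : Type*} [CommRing A] {ρ ι κ : Type*} [Fintype ι] [DecidableEq ι] [Fintype κ]
  [DecidableEq κ]

theorem transvection_mem_elemMats {i j : ι} (h : i ≠ j) (c : A) :
    transvection i j c ∈ ElemMats ι A :=
  Submonoid.subset_closure ⟨i, j, c, h, rfl⟩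

theorem exists_inverse_of_mem_elemMats {ε : Matrix ι ι A} (h : ε ∈ ElemMats ι A) :
    ∃ δ ∈ ElemMats ι A, ε * δ = 1 ∧ δ * ε = 1 := by
  induction h using Submonoid.closure_induction with
  | mem x hx =>
    obtain ⟨i, j, c, hij, rfl⟩ := hx
    refine ⟨transvection i j (-c), transvection_mem_elemMats hij _, ?_, ?_⟩ <;>
      simp [transvection_mul_transvection_same, hij]
  | one => exact ⟨1, one_mem _, by simp, by simp⟩
  | mul x y _ _ hx hy =>
    obtain ⟨a, ha, h1, h2⟩ := hx
    obtain ⟨b, hb, h3, h4⟩ := hy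
    refine ⟨b * a, mul_mem hb ha, ?_, ?_⟩
    · rw [mul_assoc, ← mul_assoc y, h3, one_mul, h1]
    · rw [mul_assoc, ← mul_assoc a, h2, one_mul, h4]

/-- A matrix supported on pairs going from outside a set of indices into it is
strictly "block triangular", and adding the identity gives an elementary matrix. -/
theorem one_add_mem_elemMats (p : ι → Prop) (C : Matrix ι ι A)
    (hC : ∀ i j, C i j ≠ 0 → p i ∧ ¬ p j) : 1 + C ∈ ElemMats ι A := by
  classical
  have key : ∀ s : Finset (ι × ι), (∀ x ∈ s, p x.1 ∧ ¬ p x.2) →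
      1 + ∑ x ∈ s, Matrix.single x.1 x.2 (C x.1 x.2) ∈ ElemMats ι A := by
    intro s
    induction s using Finset.induction_on with
    | empty => intro _; simp
    | insert x s hx ih =>
      intro h
      have hx' := h x (Finset.mem_insert_self _ _)
      have hs := ih fun y hy => h y (Finset.mem_insert_of_mem hy)
      have hne : x.1 ≠ x.2 := fun e => hx'.2 (e ▸ hx'.1)
      have := mul_mem hs (transvection_mem_elemMats hne (C x.1 x.2))
      have e : (∑ y ∈ s, Matrix.single y.1 y.2 (C y.1 y.2)) * Matrix.single x.1 x.2 (C x.1 x.2)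
          = 0 := by
        rw [Finset.sum_mul]
        refine Finset.sum_eq_zero fun y hy => ?_
        refine Matrix.single_mul_single_of_ne _ _ _ _ ?_ _
        intro e
        exact (h y (Finset.mem_insert_of_mem hy)).2 (e ▸ hx'.1)
      rw [transvection, mul_add, mul_one, add_mul, one_mul, e, add_zero] at this
      rw [Finset.sum_insert hx, add_comm (Matrix.single _ _ _), ← add_assoc]
      exact this
  have h := key (Finset.univ.filter fun x => p x.1 ∧ ¬ p x.2) (by simp)
  convert h using 2
  ext i j
  rw [Matrix.sum_apply, Finset.sum_filter, Fintype.sum_prod_type,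
    Finset.sum_eq_single i, Finset.sum_eq_single j]
  · by_cases hc : C i j = 0
    · simp [hc]
    · simp [hC i j hc]
  · intro b _ hb; split_ifs <;> simp [hb]
  · simp
  · intro b _ hb
    refine Finset.sum_eq_zero fun k _ => ?_
    split_ifs <;> simp [hb]
  · simp

def RowEquiv (v w : ι → A) : Prop := ∃ ε ∈ ElemMats ι A, v ᵥ* ε = w

def ColEquiv (M N : Matrix ρ ι A) : Prop := ∃ ε ∈ ElemMats ι A, M * ε = N

theorem RowEquiv.trans {u v w : ι → A} (h : RowEquiv u v) (h' : RowEquiv v w) : RowEquiv u w := by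
  obtain ⟨ε, hε, rfl⟩ := h
  obtain ⟨δ, hδ, rfl⟩ := h'
  exact ⟨ε * δ, mul_mem hε hδ, by simp⟩

theorem ColEquiv.refl (v : Matrix ρ ι A) : ColEquiv v v := ⟨1, one_mem _, by simp⟩

theorem ColEquiv.trans {u v w : Matrix ρ ι A} (h : ColEquiv u v) (h' : ColEquiv v w) :
    ColEquiv u w := by
  obtain ⟨ε, hε, rfl⟩ := h
  obtain ⟨δ, hδ, rfl⟩ := h'
  exact ⟨ε * δ, mul_mem hε hδ, by rw [Matrix.mul_assoc]⟩

theorem ColEquiv.row {M N : Matrix ρ ι A} (h : ColEquiv M N) (i : ρ) : RowEquiv (M i) (N i) := by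
  obtain ⟨ε, hε, rfl⟩ := h
  exact ⟨ε, hε, by rw [← Matrix.mul_apply_eq_vecMul]⟩

theorem ColEquiv.exists_right_inverse [Fintype ρ] [DecidableEq ρ] {M N : Matrix ρ ι A}
    (h : ColEquiv M N)
    (hM : ∃ U : Matrix ι ρ A, M * U = 1) : ∃ U : Matrix ι ρ A, N * U = 1 := by
  obtain ⟨ε, hε, rfl⟩ := h
  obtain ⟨δ, hδ, h, -⟩ := exists_inverse_of_mem_elemMats hε
  obtain ⟨U, hU⟩ := hM
  refine ⟨δ * U, ?_⟩
  rw [Matrix.mul_assoc, ← Matrix.mul_assoc ε, h, Matrix.one_mul, hU]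

theorem mem_span_range_iff_dotProduct {v : ι → A} {x : A} :
    x ∈ Ideal.span (Set.range v) ↔ ∃ u : ι → A, v ⬝ᵥ u = x := by
  rw [Ideal.mem_span_range_iff_exists_fun]
  simp [dotProduct, mul_comm]

theorem unim_iff {v : ι → A} : Unim v ↔ ∃ u : ι → A, v ⬝ᵥ u = 1 := by
  rw [Unim, Ideal.eq_top_iff_one, mem_span_range_iff_dotProduct]

theorem RowEquiv.unim {v w : ι → A} (h : RowEquiv v w) (hv : Unim v) : Unim w := by
  obtain ⟨ε, hε, rfl⟩ := h
  obtain ⟨δ, hδ, h, -⟩ := exists_inverse_of_mem_elemMats hε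
  obtain ⟨u, hu⟩ := unim_iff.1 hv
  refine unim_iff.2 ⟨δ *ᵥ u, ?_⟩
  rw [dotProduct_mulVec, vecMul_vecMul, h, vecMul_one, hu]

/-- Entries outside `T` may be changed by anything in the ideal spanned by the entries in `T`. -/
theorem rowEquiv_of_sub_mem_span (T : Set ι) {v w : ι → A} (h1 : ∀ i ∈ T, w i = v i)
    (h2 : ∀ i ∉ T, w i - v i ∈ Ideal.span (v '' T)) : RowEquiv v w := by
  classical
  have hs : ∀ x ∈ Ideal.span (v '' T), ∃ u : ι → A, (∀ i ∉ T, u i = 0) ∧ v ⬝ᵥ u = x := by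
    intro x hx
    induction hx using Submodule.span_induction with
    | mem x hx =>
      obtain ⟨i, hi, rfl⟩ := hx
      refine ⟨Pi.single i 1, fun j hj => ?_, by simp⟩
      exact Pi.single_eq_of_ne (by rintro rfl; exact hj hi) _
    | zero => exact ⟨0, by simp, by simp⟩
    | add x y _ _ hx hy =>
      obtain ⟨a, ha, rfl⟩ := hx
      obtain ⟨b, hb, rfl⟩ := hy
      exact ⟨a + b, fun i hi => by simp [ha i hi, hb i hi], by simp⟩
    | smul c x _ hx =>
      obtain ⟨a, ha, rfl⟩ := hx
      exact ⟨c • a, fun i hi => by simp [ha i hi], by simp⟩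
  have h3 : ∀ j, ∃ u : ι → A, (∀ i, u i ≠ 0 → i ∈ T ∧ j ∉ T) ∧ v ⬝ᵥ u = w j - v j := by
    intro j
    by_cases hj : j ∈ T
    · exact ⟨0, by simp, by simp [h1 j hj]⟩
    · obtain ⟨u, hu, e⟩ := hs _ (h2 j hj)
      refine ⟨u, fun i hi => ⟨?_, hj⟩, e⟩
      by_contra h
      exact hi (hu i h)
  choose u hu e using h3
  refine ⟨1 + of fun i j => u j i, one_add_mem_elemMats (· ∈ T) _ fun i j => hu j i, ?_⟩
  ext j
  rw [vecMul_add, vecMul_one, Pi.add_apply]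
  change v j + v ⬝ᵥ u j = w j
  rw [e]; ring

end Basic

section Blocks
variable {A : Type*} [CommRing A] {ρ ι κ : Type*} [Fintype ι] [DecidableEq ι] [Fintype κ]
  [DecidableEq κ]

theorem fromBlocks_one_zero_one_mem_elemMats (C : Matrix ι κ A) :
    fromBlocks 1 C 0 1 ∈ ElemMats (ι ⊕ κ) A := by
  have := one_add_mem_elemMats (fun x : ι ⊕ κ => x.isLeft) (fromBlocks 0 C 0 0) (by
    rintro (i | i) (j | j) <;> simp)
  rwa [← fromBlocks_one, fromBlocks_add, add_zero, zero_add, add_zero, add_zero] at this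

theorem fromBlocks_one_one_zero_mem_elemMats (C : Matrix κ ι A) :
    fromBlocks 1 0 C 1 ∈ ElemMats (ι ⊕ κ) A := by
  have := one_add_mem_elemMats (fun x : ι ⊕ κ => x.isRight) (fromBlocks 0 0 C 0) (by
    rintro (i | i) (j | j) <;> simp)
  rwa [← fromBlocks_one, fromBlocks_add, add_zero, zero_add, add_zero, zero_add] at this

theorem fromBlocks_left_mem_elemMats {ε : Matrix ι ι A} (h : ε ∈ ElemMats ι A) :
    fromBlocks ε 0 0 1 ∈ ElemMats (ι ⊕ κ) A := by
  induction h using Submonoid.closure_induction with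
  | mem x hx =>
    obtain ⟨i, j, c, hij, rfl⟩ := hx
    have := TransvectionStruct.toMatrix_sumInl (p := κ) (⟨i, j, hij, c⟩ : TransvectionStruct ι A)
    simp only [TransvectionStruct.toMatrix] at this
    rw [← this]
    exact transvection_mem_elemMats (TransvectionStruct.hij _) _
  | one => simp
  | mul x y _ _ hx hy => simpa [fromBlocks_multiply] using mul_mem hx hy

theorem reindex_mem_elemMats (e : ι ≃ κ) {ε : Matrix ι ι A} (h : ε ∈ ElemMats ι A) :
    reindex e e ε ∈ ElemMats κ A := by
  induction h using Submonoid.closure_induction with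
  | mem x hx =>
    obtain ⟨i, j, c, hij, rfl⟩ := hx
    have := TransvectionStruct.toMatrix_reindexEquiv e (⟨i, j, hij, c⟩ : TransvectionStruct ι A)
    simp only [TransvectionStruct.toMatrix] at this
    rw [coe_reindexAlgEquiv] at this
    rw [← this]
    exact transvection_mem_elemMats (TransvectionStruct.hij _) _
  | one => simp
  | mul x y _ _ hx hy =>
    have := mul_mem hx hy
    rwa [reindex_apply, reindex_apply, submatrix_mul_equiv] at this

theorem fromBlocks_right_mem_elemMats {ε : Matrix κ κ A} (h : ε ∈ ElemMats κ A) :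
    fromBlocks 1 0 0 ε ∈ ElemMats (ι ⊕ κ) A := by
  have := reindex_mem_elemMats (Equiv.sumComm κ ι) (fromBlocks_left_mem_elemMats (κ := ι) h)
  simpa [reindex_apply] using this

theorem RowEquiv.comp {v w : ι → A} (h : RowEquiv v w) (e : κ ≃ ι) :
    RowEquiv (v ∘ e) (w ∘ e) := by
  obtain ⟨ε, hε, rfl⟩ := h
  refine ⟨_, reindex_mem_elemMats e.symm hε, ?_⟩
  rw [reindex_apply, Equiv.symm_symm, submatrix_vecMul_equiv]
  congr 2
  ext; simp

theorem colEquiv_fromCols_left {M M' : Matrix ρ ι A} (h : ColEquiv M M') (N : Matrix ρ κ A) :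
    ColEquiv (fromCols M N) (fromCols M' N) := by
  obtain ⟨ε, hε, rfl⟩ := h
  exact ⟨_, fromBlocks_left_mem_elemMats hε, by simp [fromCols_mul_fromBlocks]⟩

theorem colEquiv_fromCols_right (M : Matrix ρ ι A) {N N' : Matrix ρ κ A} (h : ColEquiv N N')  :
    ColEquiv (fromCols M N) (fromCols M N') := by
  obtain ⟨ε, hε, rfl⟩ := h
  exact ⟨_, fromBlocks_right_mem_elemMats hε, by simp [fromCols_mul_fromBlocks]⟩

theorem colEquiv_fromCols_add_right (M : Matrix ρ ι A) (N : Matrix ρ κ A) (C : Matrix ι κ A) :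
    ColEquiv (fromCols M N) (fromCols M (N + M * C)) :=
  ⟨_, fromBlocks_one_zero_one_mem_elemMats C, by simp [fromCols_mul_fromBlocks, add_comm]⟩

theorem colEquiv_fromCols_add_left (M : Matrix ρ ι A) (N : Matrix ρ κ A) (C : Matrix κ ι A) :
    ColEquiv (fromCols M N) (fromCols (M + N * C) N) :=
  ⟨_, fromBlocks_one_one_zero_mem_elemMats C, by simp [fromCols_mul_fromBlocks]⟩

theorem rowEquiv_sumElim_left {p p' : ι → A} (h : RowEquiv p p') (τ : κ → A) :
    RowEquiv (Sum.elim p τ) (Sum.elim p' τ) := by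
  obtain ⟨ε, hε, rfl⟩ := h
  exact ⟨_, fromBlocks_left_mem_elemMats hε, by simp [vecMul_fromBlocks]⟩

/-- Change one entry by an element of the ideal spanned by a set of other entries. -/
theorem rowEquiv_change (i : ι) (S : Set ι) (hS : i ∉ S) {v w : ι → A}
    (h1 : ∀ k, k ≠ i → w k = v k) (h2 : w i - v i ∈ Ideal.span (v '' S)) : RowEquiv v w := by
  refine rowEquiv_of_sub_mem_span {i}ᶜ (fun k hk => h1 k hk) fun k hk => ?_
  obtain rfl : k = i := by simpa using hk
  exact Ideal.span_mono (Set.image_mono fun x hx => by rintro rfl; exact hS hx) h2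

theorem rowEquiv_transvection (i j : ι) (h : i ≠ j) (c : A) {v w : ι → A}
    (h1 : ∀ k, k ≠ j → w k = v k) (h2 : w j = v j + v i * c) : RowEquiv v w := by
  refine rowEquiv_change j {i} (by simpa using h.symm) h1 ?_
  rw [h2, Set.image_singleton, Ideal.mem_span_singleton]
  exact ⟨c, by ring⟩

/-- Scale two entries by `x` and `y`, which are inverse modulo an ideal spanned by other
entries. -/
theorem rowEquiv_scale (i j : ι) (h : i ≠ j) (S : Set ι) (hi : i ∉ S) (hj : j ∉ S) (x y : A)
    {v w : ι → A} (hxy : x * y - 1 ∈ Ideal.span (v '' S))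
    (h0 : ∀ k, k ≠ i → k ≠ j → w k = v k) (h1 : w i = v i * x) (h2 : w j = v j * y) :
    RowEquiv v w := by
  classical
  set f : A → A → ι → A := fun a b => Function.update (Function.update v i a) j b with hf
  have fi : ∀ a b, f a b i = a := fun a b => by simp [hf, h]
  have fj : ∀ a b, f a b j = b := fun a b => by simp [hf]
  have fk : ∀ a b k, k ≠ i → k ≠ j → f a b k = v k := fun a b k h1 h2 => by simp [hf, h1, h2]
  have ti : ∀ a b c, RowEquiv (f a b) (f (a + b * c) b) := fun a b c =>
    rowEquiv_transvection j i h.symm c (fun k hk => by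
      by_cases hj : k = j
      · subst hj; simp [fj]
      · simp [fk _ _ k hk hj]) (by simp [fi, fj])
  have tj : ∀ a b c, RowEquiv (f a b) (f a (b + a * c)) := fun a b c =>
    rowEquiv_transvection i j h c (fun k hk => by
      by_cases hi : k = i
      · subst hi; simp [fi]
      · simp [fk _ _ k hi hk]) (by simp [fi, fj])
  have hfS : ∀ a b, f a b '' S = v '' S := fun a b =>
    Set.image_congr fun k hk => fk a b k (by rintro rfl; exact hi hk) (by rintro rfl; exact hj hk)
  have key : ∀ a b a' b', a' - a ∈ Ideal.span (v '' S) → b' - b ∈ Ideal.span (v '' S) →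
      RowEquiv (f a b) (f a' b') := by
    intro a b a' b' ha hb
    refine (rowEquiv_change i S hi (w := f a' b) (fun k hk => ?_) ?_).trans
      (rowEquiv_change j S hj (fun k hk => ?_) ?_)
    · by_cases hj : k = j
      · subst hj; simp [fj]
      · simp [fk _ _ k hk hj]
    · rwa [hfS, fi, fi]
    · by_cases hj : k = i
      · subst hj; simp [fi]
      · simp [fk _ _ k hj hk]
    · rwa [hfS, fj, fj]
  have e1 : v = f (v i) (v j) := by simp [hf]
  have e2 : w = f (v i * x) (v j * y) := by
    ext k
    by_cases hi : k = i
    · subst hi; rw [fi, h1]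
    · by_cases hj : k = j
      · subst hj; rw [fj, h2]
      · rw [fk _ _ _ hi hj, h0 k hi hj]
  rw [e1, e2]
  generalize v i = p at *
  generalize v j = q at *
  refine (ti p q (-1)).trans ((tj _ _ 1).trans ((ti _ _ (-1)).trans ((ti _ _ x).trans
    ((tj _ _ (-y)).trans ((ti _ _ x).trans (key _ _ _ _ ?_ ?_))))))
  · convert Ideal.mul_mem_left _ (p * x - q) hxy using 1
    ring
  · convert Ideal.mul_mem_left _ p hxy using 1
    ring

end Blocks

section Dimension
variable {A : Type*} [CommRing A]

/-- Every chain of primes containing `I` has length at most `d - k`. -/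
def CodimGE (d : ℕ) (I : Ideal A) (k : ℕ) : Prop :=
  ∀ p : LTSeries (PrimeSpectrum A), I ≤ p.head.asIdeal → p.length + k ≤ d

theorem codimGE_bot {d : ℕ} (h : ringKrullDim A ≤ d) : CodimGE d (⊥ : Ideal A) 0 := by
  intro p _
  have := (Order.LTSeries.length_le_krullDim p).trans h
  simpa using this

theorem CodimGE.mono {d k : ℕ} {I J : Ideal A} (h : CodimGE d I k) (hIJ : I ≤ J) :
    CodimGE d J k := fun p hp => h p (hIJ.trans hp)

theorem CodimGE.mul {d k : ℕ} {I J : Ideal A} (h : CodimGE d I k) (h' : CodimGE d J k) :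
    CodimGE d (I * J) k := fun p hp =>
  (p.head.isPrime.mul_le.1 hp).elim (h p) (h' p)

theorem CodimGE.eq_top {d k : ℕ} {I : Ideal A} (h : CodimGE d I k) (hk : d < k) : I = ⊤ := by
  by_contra hI
  obtain ⟨m, hm, hle⟩ := Ideal.exists_le_maximal I hI
  have := h (RelSeries.singleton _ ⟨m, hm.isPrime⟩) hle
  simp at this
  omega

theorem exists_series_cons {I : Ideal A} (p : LTSeries (PrimeSpectrum A))
    (hI : I ≤ p.head.asIdeal)
    (x : A) (hx : x ∈ p.head.asIdeal) (hmin : ∀ q ∈ I.minimalPrimes, q ≤ p.head.asIdeal → x ∉ q) :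
    ∃ p' : LTSeries (PrimeSpectrum A), I ≤ p'.head.asIdeal ∧ p'.length = p.length + 1 := by
  obtain ⟨q, hq, hle⟩ := Ideal.exists_minimalPrimes_le hI
  have hlt : (⟨q, hq.1.1⟩ : PrimeSpectrum A) < p.head := by
    refine lt_of_le_of_ne hle fun e => hmin q hq hle ?_
    rw [← e] at hx
    exact hx
  refine ⟨p.cons _ hlt, ?_, by simp⟩
  simpa using hq.1.2

theorem exists_forall_add_sum_notMem {ι : Type*} [Fintype ι] (Q : Finset (PrimeSpectrum A))
    (g : PrimeSpectrum A → A) (f : PrimeSpectrum A → ι → A)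
    (h : ∀ p ∈ Q, g p ∉ p.asIdeal ∨ ∃ j, f p j ∉ p.asIdeal) :
    ∃ c : ι → A, ∀ p ∈ Q, g p + c ⬝ᵥ f p ∉ p.asIdeal := by
  classical
  induction hn : Q.card generalizing Q with
  | zero => exact ⟨0, by simp [Finset.card_eq_zero.1 hn]⟩
  | succ n ih =>
    obtain ⟨p₀, hp₀, hmin⟩ := Q.exists_minimal (Finset.card_pos.1 (by omega))
    obtain ⟨c, hc⟩ := ih (Q.erase p₀) (fun p hp => h p (Finset.mem_of_mem_erase hp))
      (by rw [Finset.card_erase_of_mem hp₀]; omega)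
    by_cases h0 : g p₀ + c ⬝ᵥ f p₀ ∈ p₀.asIdeal
    · have hj : ∃ j, f p₀ j ∉ p₀.asIdeal := by
        rcases h p₀ hp₀ with h1 | h1
        · by_contra! hall
          refine h1 ((Ideal.add_mem_iff_left _ ?_).1 h0)
          exact Ideal.sum_mem _ fun j _ => Ideal.mul_mem_left _ _ (hall j)
        · exact h1
      obtain ⟨j, hj⟩ := hj
      have hr : ∀ q : PrimeSpectrum A, ∃ r, q ∈ Q.erase p₀ → r ∈ q.asIdeal ∧ r ∉ p₀.asIdeal := by
        intro q
        by_cases hq : q ∈ Q.erase p₀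
        · have : ¬ q.asIdeal ≤ p₀.asIdeal := by
            intro hle
            have := hmin (Finset.mem_of_mem_erase hq) hle
            exact Finset.ne_of_mem_erase hq (le_antisymm hle this)
          obtain ⟨r, hr, hr'⟩ := Set.not_subset.1 this
          exact ⟨r, fun _ => ⟨hr, hr'⟩⟩
        · exact ⟨0, fun h => (hq h).elim⟩
      choose r hr using hr
      refine ⟨c + Pi.single j (∏ q ∈ Q.erase p₀, r q), fun p hp => ?_⟩
      rw [add_dotProduct, ← add_assoc, single_dotProduct]
      by_cases hpp : p = p₀
      · subst hpp
        rw [Ideal.add_mem_iff_right _ h0]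
        intro hmem
        rcases p.isPrime.mem_or_mem hmem with h1 | h1
        · obtain ⟨q, hq, hq'⟩ := (p.isPrime.prod_mem_iff).1 h1
          exact (hr q hq).2 hq'
        · exact hj h1
      · have hp' : p ∈ Q.erase p₀ := Finset.mem_erase.2 ⟨hpp, hp⟩
        rw [Ideal.add_mem_iff_left]
        · exact hc p hp'
        · exact Ideal.mul_mem_right _ _
            (Ideal.mem_of_dvd _ (Finset.dvd_prod_of_mem r hp') (hr p hp').1)
    · exact ⟨c, fun p hp => by
        by_cases hpp : p = p₀
        · subst hpp; exact h0
        · exact hc p (Finset.mem_erase.2 ⟨hpp, hp⟩)⟩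

variable {ι : Type*} [Fintype ι] [DecidableEq ι]

/-- The ideal generated by the second-row entries in the columns `T`. -/
def rowIdeal (M : Matrix (Fin 2) ι A) (T : Finset ι) : Ideal A :=
  Ideal.span {x | ∃ i ∈ T, x = M 1 i}

/-- The ideal generated by the `2 × 2` minors on the columns `T`. -/
def minorIdeal (M : Matrix (Fin 2) ι A) (T : Finset ι) : Ideal A :=
  Ideal.span {x | ∃ i ∈ T, ∃ j ∈ T, x = M 0 i * M 1 j - M 0 j * M 1 i}

theorem rowIdeal_congr {M M' : Matrix (Fin 2) ι A} {T : Finset ι}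
    (h : ∀ i ∈ T, ∀ r, M' r i = M r i) : rowIdeal M' T = rowIdeal M T := by
  refine congrArg Ideal.span (Set.ext fun x => exists_congr fun i => and_congr_right fun hi => ?_)
  rw [h i hi]

theorem minorIdeal_congr {M M' : Matrix (Fin 2) ι A} {T : Finset ι}
    (h : ∀ i ∈ T, ∀ r, M' r i = M r i) : minorIdeal M' T = minorIdeal M T := by
  refine congrArg Ideal.span (Set.ext fun x => exists_congr fun i => and_congr_right fun hi =>
    exists_congr fun j => and_congr_right fun hj => ?_)
  rw [h i hi, h i hi, h j hj, h j hj]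

theorem exists_general_position_step [IsNoetherianRing A] {d k : ℕ} (I : Ideal A)
    (M : Matrix (Fin 2) ι A)
    (hM : ∃ U : Matrix ι (Fin 2) A, M * U = 1) (T : Finset ι) (t : ι) (ht : t ∉ T)
    (hB : CodimGE d (I ⊔ rowIdeal M T) (k + T.card))
    (hD : CodimGE (d + 1) (I ⊔ minorIdeal M T) (k + T.card)) :
    ∃ M', ColEquiv M M' ∧ (∀ i ∈ T, ∀ r, M' r i = M r i) ∧
      CodimGE d (I ⊔ rowIdeal M' (insert t T)) (k + (insert t T).card) ∧
      CodimGE (d + 1) (I ⊔ minorIdeal M' (insert t T)) (k + (insert t T).card) := by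
  classical
  obtain ⟨U, hU⟩ := hM
  have hU' : ∀ r s, ∑ j, M r j * U j s = (1 : Matrix (Fin 2) (Fin 2) A) r s := fun r s => by
    rw [← hU, Matrix.mul_apply]
  have fin1 := Ideal.finite_minimalPrimes_of_isNoetherianRing A (I ⊔ rowIdeal M T)
  have fin2 := Ideal.finite_minimalPrimes_of_isNoetherianRing A (I ⊔ minorIdeal M T)
  set Q1 : Set (PrimeSpectrum A) := {p | p.asIdeal ∈ (I ⊔ rowIdeal M T).minimalPrimes} with hQ1
  set Q2 : Set (PrimeSpectrum A) := {p | p.asIdeal ∈ (I ⊔ minorIdeal M T).minimalPrimes ∧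
    ∃ i ∈ T, M 1 i ∉ p.asIdeal} with hQ2
  have inj : Function.Injective (PrimeSpectrum.asIdeal (R := A)) := fun p q h =>
    PrimeSpectrum.ext h
  have f1 : Q1.Finite := fin1.preimage inj.injOn
  have f2 : Q2.Finite := (fin2.preimage inj.injOn).subset fun p hp => hp.1
  have hx : ∀ p : PrimeSpectrum A, ∃ y : A × A, (p ∈ Q1 → y = (0, 1)) ∧ (p ∈ Q2 →
      ∃ i ∈ T, M 1 i ∉ p.asIdeal ∧ y = (M 1 i, - M 0 i)) := by
    intro p
    by_cases h1 : p ∈ Q1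
    · refine ⟨(0, 1), fun _ => rfl, fun h2 => ?_⟩
      obtain ⟨i, hi, hi'⟩ := h2.2
      exact (hi' (h1.1.2 (Ideal.mem_sup_right (Ideal.subset_span ⟨i, hi, rfl⟩)))).elim
    · by_cases h2 : p ∈ Q2
      · obtain ⟨i, hi, hi'⟩ := h2.2
        exact ⟨_, fun h => (h1 h).elim, fun _ => ⟨i, hi, hi', rfl⟩⟩
      · exact ⟨0, fun h => (h1 h).elim, fun h => (h2 h).elim⟩
  choose y hy1 hy2 using hx
  set φ : PrimeSpectrum A → ι → A := fun p j => (y p).1 * M 0 j + (y p).2 * M 1 j with hφ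
  have hex : ∀ p ∈ Q1 ∪ Q2, ∃ j ∉ T, φ p j ∉ p.asIdeal := by
    rintro p (hp | hp)
    · by_contra! hall
      have : ∀ j, M 1 j ∈ p.asIdeal := by
        intro j
        by_cases hj : j ∈ T
        · exact hp.1.2 (Ideal.mem_sup_right (Ideal.subset_span ⟨j, hj, rfl⟩))
        · simpa [hφ, hy1 p hp] using hall j hj
      apply p.isPrime.ne_top
      rw [Ideal.eq_top_iff_one]
      have e := hU' 1 1
      rw [Matrix.one_apply_eq] at e
      rw [← e]
      exact Ideal.sum_mem _ fun j _ => Ideal.mul_mem_right _ _ (this j)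
    · obtain ⟨i, hi, hi', hyi⟩ := hy2 p hp
      by_contra! hall
      have : ∀ j, φ p j ∈ p.asIdeal := by
        intro j
        by_cases hj : j ∈ T
        · refine hp.1.1.2 (Ideal.mem_sup_right (Ideal.subset_span ⟨j, hj, i, hi, ?_⟩))
          simp [hφ, hyi]; ring
        · exact hall j hj
      apply hi'
      have e : M 1 i = ∑ j, φ p j * U j 0 := by
        have e0 := hU' 0 0
        have e1 := hU' 1 0
        simp only [hφ, hyi, add_mul, Finset.sum_add_distrib, mul_assoc, ← Finset.mul_sum, e0, e1]
        simp
      rw [e]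
      exact Ideal.sum_mem _ fun j _ => Ideal.mul_mem_right _ _ (this j)
  obtain ⟨c, hc⟩ := exists_forall_add_sum_notMem (f1.union f2).toFinset (fun p => φ p t)
    (fun p j => if j ∈ insert t T then 0 else φ p j) (by
      intro p hp
      obtain ⟨j, hj, hj'⟩ := hex p (by simpa using hp)
      by_cases hjt : j = t
      · subst hjt; exact Or.inl hj'
      · exact Or.inr ⟨j, by simpa [hj, hjt] using hj'⟩)
  set e : Matrix ι ι A := of fun i j => if j = t ∧ i ∉ insert t T then c i else 0 with he
  have hel : 1 + e ∈ ElemMats ι A := by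
    refine one_add_mem_elemMats (· ≠ t) e fun i j hij => ?_
    simp only [he, of_apply, ne_eq, ite_eq_right_iff, Classical.not_imp] at hij
    refine ⟨fun h => hij.1.2 (by simp [h]), by simpa using hij.1.1⟩
  obtain ⟨M₁, hM₁⟩ : ∃ M₁ : Matrix (Fin 2) ι A, M₁ = M * (1 + e) := ⟨_, rfl⟩
  have hne : ∀ j ≠ t, ∀ r, M₁ r j = M r j := by
    intro j hj r
    rw [hM₁, Matrix.mul_add, Matrix.mul_one, Matrix.add_apply, Matrix.mul_apply]
    simp [he, hj]
  have hφt : ∀ p ∈ Q1 ∪ Q2, (y p).1 * M₁ 0 t + (y p).2 * M₁ 1 t ∉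
      p.asIdeal := by
    intro p hp
    convert hc p (by simpa using hp) using 1
    simp only [hM₁, Matrix.mul_add, Matrix.mul_one, Matrix.add_apply, Matrix.mul_apply,
      dotProduct, hφ,
      mul_add, Finset.mul_sum]
    rw [add_add_add_comm, ← Finset.sum_add_distrib]
    congr! 2
    refine Finset.sum_congr rfl fun j _ => ?_
    by_cases hj : j ∈ insert t T
    · simp only [he, of_apply, hj, not_true_eq_false, and_false, if_false, if_true, mul_zero,
        add_zero]
    · simp only [he, of_apply, hj, not_false_eq_true, and_self, if_true, if_false]
      ring
  have hT : ∀ i ∈ T, ∀ r, M₁ r i = M r i := fun i hi =>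
    hne i (by rintro rfl; exact ht hi)
  refine ⟨M₁, ⟨_, hel, hM₁.symm⟩, hT, ?_, ?_⟩
  · intro p hp
    rw [sup_le_iff] at hp
    obtain ⟨p', h1, h2⟩ := exists_series_cons (I := I ⊔ rowIdeal M T) p (by
        refine sup_le hp.1 (le_trans ?_ hp.2)
        rw [← rowIdeal_congr hT]
        exact Ideal.span_mono fun x ⟨i, hi, hx⟩ => ⟨i, Finset.mem_insert_of_mem hi, hx⟩)
      (M₁ 1 t) (hp.2 (Ideal.subset_span ⟨t, Finset.mem_insert_self _ _, rfl⟩))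
      (fun q hq hle => by
        have hq1 : (⟨q, hq.1.1⟩ : PrimeSpectrum A) ∈ Q1 := hq
        have := hφt _ (Or.inl hq1)
        simpa [hy1 _ hq1] using this)
    have := hB p' h1
    rw [Finset.card_insert_of_notMem ht]
    omega
  · intro p hp
    rw [sup_le_iff] at hp
    rw [Finset.card_insert_of_notMem ht]
    by_cases hb : rowIdeal M T ≤ p.head.asIdeal
    · have := hB p (sup_le hp.1 hb)
      omega
    · obtain ⟨i₀, hi₀, hn₀⟩ : ∃ i ∈ T, M 1 i ∉ p.head.asIdeal := by
        by_contra! hall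
        refine hb (Ideal.span_le.2 ?_)
        rintro x ⟨i, hi, rfl⟩
        exact hall i hi
      have hle : I ⊔ minorIdeal M T ≤ p.head.asIdeal := by
        refine sup_le hp.1 (le_trans ?_ hp.2)
        rw [← minorIdeal_congr hT]
        exact Ideal.span_mono fun x ⟨i, hi, j, hj, hx⟩ =>
          ⟨i, Finset.mem_insert_of_mem hi, j, Finset.mem_insert_of_mem hj, hx⟩
      obtain ⟨q, hq, hqle⟩ := Ideal.exists_minimalPrimes_le hle
      have hq2 : (⟨q, hq.1.1⟩ : PrimeSpectrum A) ∈ Q2 := ⟨hq, i₀, hi₀, fun h => hn₀ (hqle h)⟩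
      obtain ⟨i, hi, hni, hyi⟩ := hy2 _ hq2
      have hnot := hφt _ (Or.inr hq2)
      rw [hyi] at hnot
      have hin : M₁ 0 t * M₁ 1 i - M₁ 0 i * M₁ 1 t
          ∈ p.head.asIdeal :=
        hp.2 (Ideal.subset_span ⟨t, Finset.mem_insert_self _ _, i,
          Finset.mem_insert_of_mem hi, rfl⟩)
      rw [hT i hi, hT i hi] at hin
      have hlt : (⟨q, hq.1.1⟩ : PrimeSpectrum A) < p.head := by
        refine lt_of_le_of_ne hqle fun e' => hnot ?_
        rw [e']
        convert hin using 1
        ring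
      have := hD (p.cons _ hlt) (by simpa using hq.1.2)
      simp at this
      omega

theorem exists_general_position [IsNoetherianRing A] {d k : ℕ} (I : Ideal A)
    (hI : CodimGE d I k) (M : Matrix (Fin 2) ι A)
    (hM : ∃ U : Matrix ι (Fin 2) A, M * U = 1) (T : Finset ι) :
    ∃ M', ColEquiv M M' ∧
      CodimGE d (I ⊔ rowIdeal M' T) (k + T.card) ∧
      CodimGE (d + 1) (I ⊔ minorIdeal M' T) (k + T.card) := by
  induction T using Finset.induction_on with
  | empty =>
    refine ⟨M, ColEquiv.refl M, by simpa using hI.mono le_sup_left, fun p hp => ?_⟩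
    have := hI p (le_sup_left.trans hp)
    simp
    omega
  | insert t T ht ih =>
    obtain ⟨M', h1, h2, h3⟩ := ih
    obtain ⟨M'', h4, -, h5, h6⟩ := exists_general_position_step I M'
      (h1.exists_right_inverse hM) T t ht h2 h3
    exact ⟨M'', h1.trans h4, h5, h6⟩

end Dimension

section Lift
variable {A R : Type*} [CommRing A] [CommRing R] {ρ ι κ : Type*} [Fintype ι] [DecidableEq ι]
  [Fintype κ] [DecidableEq κ]

theorem exists_lift_of_mem_elemMats {f : A →+* R} (hf : Function.Surjective f) {ε : Matrix ι ι R}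
    (h : ε ∈ ElemMats ι R) : ∃ δ ∈ ElemMats ι A, δ.map f = ε := by
  induction h using Submonoid.closure_induction with
  | mem x hx =>
    obtain ⟨i, j, c, hij, rfl⟩ := hx
    obtain ⟨c, rfl⟩ := hf c
    refine ⟨_, transvection_mem_elemMats hij c, ?_⟩
    ext k l
    simp only [transvection, Matrix.map_apply, Matrix.add_apply, map_add, Matrix.one_apply,
      Matrix.single_apply]
    split_ifs <;> simp
  | one => exact ⟨1, one_mem _, by simp⟩
  | mul x y _ _ hx hy =>
    obtain ⟨a, ha, rfl⟩ := hx
    obtain ⟨b, hb, rfl⟩ := hy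
    exact ⟨a * b, mul_mem ha hb, Matrix.map_mul⟩

theorem ColEquiv.exists_lift {f : A →+* R} (hf : Function.Surjective f) {N : Matrix ρ ι A}
    {L : Matrix ρ ι R} (h : ColEquiv (N.map f) L) : ∃ N', ColEquiv N N' ∧ N'.map f = L := by
  obtain ⟨ε, hε, rfl⟩ := h
  obtain ⟨δ, hδ, rfl⟩ := exists_lift_of_mem_elemMats hf hε
  exact ⟨N * δ, ⟨δ, hδ, rfl⟩, Matrix.map_mul⟩

theorem colEquiv_of_add_col (i : ι) (c : ι → A) (hc : c i = 0) {M M' : Matrix ρ ι A}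
    (h0 : ∀ j ≠ i, ∀ r, M' r j = M r j) (h1 : ∀ r, M' r i = M r i + M r ⬝ᵥ c) :
    ColEquiv M M' := by
  refine ⟨1 + of fun k j => if j = i then c k else 0, one_add_mem_elemMats (· ≠ i) _ ?_, ?_⟩
  · intro k j h
    simp only [of_apply, ne_eq, ite_eq_right_iff, Classical.not_imp] at h
    refine ⟨?_, by simpa using h.1⟩
    rintro rfl
    exact h.2 hc
  · ext r j
    rw [Matrix.mul_add, Matrix.mul_one, Matrix.add_apply, Matrix.mul_apply]
    by_cases hj : j = i
    · subst hj
      simp [h1, dotProduct]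
    · simp [hj, h0]

/-- If the minors on the columns `T` generate the unit ideal, then these columns generate
everything. -/
theorem exists_dotProduct_of_minorIdeal_eq_top {M : Matrix (Fin 2) ι A} {T : Finset ι}
    (h : minorIdeal M T = ⊤) (p q : A) :
    ∃ c : ι → A, (∀ i ∉ T, c i = 0) ∧ M 0 ⬝ᵥ c = p ∧ M 1 ⬝ᵥ c = q := by
  have key : ∀ x ∈ minorIdeal M T,
      ∃ c : ι → A, (∀ i ∉ T, c i = 0) ∧ M 0 ⬝ᵥ c = x * p ∧ M 1 ⬝ᵥ c = x * q := by
    intro x hx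
    induction hx using Submodule.span_induction with
    | mem x hx =>
      obtain ⟨i, hi, j, hj, rfl⟩ := hx
      refine ⟨Pi.single i (M 1 j * p - M 0 j * q) + Pi.single j (M 0 i * q - M 1 i * p),
        fun k hk => ?_, ?_, ?_⟩
      · have h1 : k ≠ i := by rintro rfl; exact hk hi
        have h2 : k ≠ j := by rintro rfl; exact hk hj
        simp [h1, h2]
      · simp only [dotProduct_add, dotProduct_single]; ring
      · simp only [dotProduct_add, dotProduct_single]; ring
    | zero => exact ⟨0, by simp, by simp, by simp⟩
    | add x y _ _ hx hy =>
      obtain ⟨a, ha, h1, h2⟩ := hx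
      obtain ⟨b, hb, h3, h4⟩ := hy
      exact ⟨a + b, fun i hi => by simp [ha i hi, hb i hi], by simp [h1, h3, add_mul],
        by simp [h2, h4, add_mul]⟩
    | smul c x _ hx =>
      obtain ⟨a, ha, h1, h2⟩ := hx
      exact ⟨c • a, fun i hi => by simp [ha i hi], by simp [h1, mul_assoc],
        by simp [h2, mul_assoc]⟩
  obtain ⟨c, h0, h1, h2⟩ := key 1 (by rw [h]; trivial)
  exact ⟨c, h0, by simpa using h1, by simpa using h2⟩

theorem exists_dotProduct_of_rowIdeal_eq_top {M : Matrix (Fin 2) ι A} {T : Finset ι}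
    (h : rowIdeal M T = ⊤) (q : A) :
    ∃ c : ι → A, (∀ i ∉ T, c i = 0) ∧ M 1 ⬝ᵥ c = q := by
  have key : ∀ x ∈ rowIdeal M T,
      ∃ c : ι → A, (∀ i ∉ T, c i = 0) ∧ M 1 ⬝ᵥ c = x := by
    intro x hx
    induction hx using Submodule.span_induction with
    | mem x hx =>
      obtain ⟨i, hi, rfl⟩ := hx
      refine ⟨Pi.single i 1, fun k hk => ?_, by simp⟩
      exact Pi.single_eq_of_ne (by rintro rfl; exact hk hi) _
    | zero => exact ⟨0, by simp, by simp⟩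
    | add x y _ _ hx hy =>
      obtain ⟨a, ha, h1⟩ := hx
      obtain ⟨b, hb, h3⟩ := hy
      exact ⟨a + b, fun i hi => by simp [ha i hi, hb i hi], by simp [h1, h3]⟩
    | smul c x _ hx =>
      obtain ⟨a, ha, h1⟩ := hx
      exact ⟨c • a, fun i hi => by simp [ha i hi], by simp [h1]⟩
  exact key q (by rw [h]; trivial)

/-- The columns of the right block of a matrix `(X | S)`. -/
def rightCols (κ : Type*) [Fintype κ] : Finset (Fin 2 ⊕ κ) :=
  Finset.univ.map Function.Embedding.inr

theorem colEquiv_fromCols_one_zero (M : Matrix (Fin 2) (Fin 2 ⊕ κ) A)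
    (hB : rowIdeal M (rightCols κ) = ⊤)
    (hF : minorIdeal M (insert (Sum.inl 1) (rightCols κ)) = ⊤) :
    ColEquiv M (fromCols 1 0) := by
  have n0 : (Sum.inl 0 : Fin 2 ⊕ κ) ∉ insert (Sum.inl 1) (rightCols κ) := by
    simp [rightCols]
  have n1 : (Sum.inl 1 : Fin 2 ⊕ κ) ∉ rightCols κ := by simp [rightCols]
  have n00 : (Sum.inl 0 : Fin 2 ⊕ κ) ∉ rightCols κ := by simp [rightCols]
  obtain ⟨c, hc, h0, h1⟩ := exists_dotProduct_of_minorIdeal_eq_top hF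
    (1 - M 0 (Sum.inl 0)) (- M 1 (Sum.inl 0))
  obtain ⟨u, hu, h2⟩ := exists_dotProduct_of_rowIdeal_eq_top hB (1 - M 1 (Sum.inl 1))
  set x := M 0 (Sum.inl 1) + M 0 ⬝ᵥ u with hx
  have s1 : ColEquiv M (M.updateCol (Sum.inl 0) ![1, 0]) := by
    refine colEquiv_of_add_col (Sum.inl 0) c (hc _ n0) (fun j hj r => by simp [hj]) fun r => ?_
    fin_cases r
    · simp [h0]
    · simp [h1]
  have s2 : ColEquiv (M.updateCol (Sum.inl 0) ![1, 0])
      ((M.updateCol (Sum.inl 0) ![1, 0]).updateCol (Sum.inl 1) ![x, 1]) := by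
    refine colEquiv_of_add_col (Sum.inl 1) u (hu _ n1) (fun j hj r => by simp [hj]) fun r => ?_
    have e : ∀ r, (M.updateCol (Sum.inl 0) ![1, 0]) r ⬝ᵥ u = M r ⬝ᵥ u := fun r => by
      refine Finset.sum_congr rfl fun j _ => ?_
      by_cases hj : j = Sum.inl 0
      · subst hj; simp [hu _ n00]
      · simp [hj]
    rw [e]
    fin_cases r
    · simp [hx]
    · simp [h2]
  have e3 : (M.updateCol (Sum.inl 0) ![1, 0]).updateCol (Sum.inl 1) ![x, 1] =
      fromCols !![1, x; 0, 1] (M.toCols₂) := by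
    ext r (j | j)
    · fin_cases j <;> fin_cases r <;> simp
    · simp
  have s3 := colEquiv_fromCols_add_right !![1, x; 0, 1] M.toCols₂ (-(!![1, -x; 0, 1] * M.toCols₂))
  have e4 : !![1, x; 0, 1] * !![1, -x; 0, 1] = (1 : Matrix (Fin 2) (Fin 2) A) := by
    ext i j; fin_cases i <;> fin_cases j <;> simp [Matrix.mul_apply]
  rw [Matrix.mul_neg, ← Matrix.mul_assoc, e4, Matrix.one_mul, add_neg_cancel] at s3
  have s4 : ColEquiv !![1, x; 0, 1] (1 : Matrix (Fin 2) (Fin 2) A) := by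
    refine ⟨transvection 0 1 (-x), transvection_mem_elemMats (by simp) _, ?_⟩
    rw [← e4]
    congr 1
    ext i j; fin_cases i <;> fin_cases j <;> simp [transvection]
  rw [← e3] at s3
  exact s1.trans (s2.trans (s3.trans (colEquiv_fromCols_left s4 _)))

theorem rowIdeal_map (f : A →+* R) (M : Matrix (Fin 2) ι A) (T : Finset ι) :
    rowIdeal (M.map f) T = (rowIdeal M T).map f := by
  rw [rowIdeal, rowIdeal, Ideal.map_span]
  congr 1
  ext x
  constructor
  · rintro ⟨i, hi, rfl⟩; exact ⟨_, ⟨i, hi, rfl⟩, rfl⟩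
  · rintro ⟨_, ⟨i, hi, rfl⟩, rfl⟩; exact ⟨i, hi, rfl⟩

theorem minorIdeal_map (f : A →+* R) (M : Matrix (Fin 2) ι A) (T : Finset ι) :
    minorIdeal (M.map f) T = (minorIdeal M T).map f := by
  rw [minorIdeal, minorIdeal, Ideal.map_span]
  congr 1
  ext x
  constructor
  · rintro ⟨i, hi, j, hj, rfl⟩; exact ⟨_, ⟨i, hi, j, hj, rfl⟩, by simp⟩
  · rintro ⟨_, ⟨i, hi, j, hj, rfl⟩, rfl⟩; exact ⟨i, hi, j, hj, by simp⟩

theorem map_mk_eq_top {I J : Ideal A} (h : I ⊔ J = ⊤) : J.map (Ideal.Quotient.mk I) = ⊤ := by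
  have := congrArg (Ideal.map (Ideal.Quotient.mk I)) h
  rwa [Ideal.map_sup, Ideal.map_quotient_self, bot_sup_eq, Ideal.map_top] at this

/-- A matrix which can be trivialized modulo `I` using `rowIdeal` and `minorIdeal`. -/
theorem colEquiv_map_mk_fromCols_one_zero (I : Ideal A) (M : Matrix (Fin 2) (Fin 2 ⊕ κ) A)
    (hB : I ⊔ rowIdeal M (rightCols κ) = ⊤)
    (hF : I ⊔ minorIdeal M (insert (Sum.inl 1) (rightCols κ)) = ⊤) :
    ColEquiv (M.map (Ideal.Quotient.mk I)) (fromCols 1 0) :=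
  colEquiv_fromCols_one_zero _ (by rw [rowIdeal_map, map_mk_eq_top hB])
    (by rw [minorIdeal_map, map_mk_eq_top hF])

theorem exists_general_position_rightCols [IsNoetherianRing A] {d k : ℕ} (I : Ideal A)
    (hI : CodimGE d I k) (M : Matrix (Fin 2) (Fin 2 ⊕ κ) A)
    (hM : ∃ U : Matrix (Fin 2 ⊕ κ) (Fin 2) A, M * U = 1) :
    ∃ M', ColEquiv M M' ∧
      CodimGE d (I ⊔ rowIdeal M' (rightCols κ)) (k + Fintype.card κ) ∧
      CodimGE d (I ⊔ minorIdeal M' (insert (Sum.inl 1) (rightCols κ))) (k + Fintype.card κ) := by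
  obtain ⟨M', h1, h2, h3⟩ := exists_general_position I hI M hM (rightCols κ)
  obtain ⟨M'', h4, h5, h6, h7⟩ := exists_general_position_step I M'
    (h1.exists_right_inverse hM) (rightCols κ) (Sum.inl 1) (by simp [rightCols]) h2 h3
  have hc : (rightCols κ).card = Fintype.card κ := by simp [rightCols]
  refine ⟨M'', h1.trans h4, ?_, fun p hp => ?_⟩
  · rw [rowIdeal_congr h5, ← hc]; exact h2
  · have := h7 p hp
    rw [Finset.card_insert_of_notMem (by simp [rightCols]), hc] at this
    omega

end Lift

section NormalForm
variable {A : Type*} [CommRing A] {κ : Type*} [Fintype κ] [DecidableEq κ]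

theorem colEquiv_one_zero_of_isUnit {X V : Matrix (Fin 2) (Fin 2) A} (h : X * V = 1)
    (s : Matrix (Fin 2) (Fin 1) A) (W : Matrix (Fin 2) (Fin 2) A) (T : Matrix (Fin 2) κ A) :
    ColEquiv (fromCols X (fromCols s (fromCols W T))) (fromCols 1 0) := by
  have s1 := colEquiv_fromCols_add_right X (fromCols s (fromCols W T))
    (V * (fromCols (0 : Matrix (Fin 2) (Fin 1) A)
      (fromCols (1 : Matrix (Fin 2) (Fin 2) A) 0) - (fromCols s (fromCols W T))))
  rw [← Matrix.mul_assoc, h, Matrix.one_mul, add_sub_cancel] at s1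
  have s2 := colEquiv_fromCols_add_left X
    (fromCols (0 : Matrix (Fin 2) (Fin 1) A)
      (fromCols (1 : Matrix (Fin 2) (Fin 2) A) (0 : Matrix (Fin 2) κ A)))
    (fromRows (0 : Matrix (Fin 1) (Fin 2) A) (fromRows (1 - X) (0 : Matrix κ (Fin 2) A)))
  rw [fromCols_mul_fromRows, fromCols_mul_fromRows] at s2
  simp only [Matrix.mul_zero, zero_add, add_zero, Matrix.one_mul, add_sub_cancel] at s2
  have s3 := colEquiv_fromCols_add_right (1 : Matrix (Fin 2) (Fin 2) A)
    (fromCols (0 : Matrix (Fin 2) (Fin 1) A)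
      (fromCols (1 : Matrix (Fin 2) (Fin 2) A) (0 : Matrix (Fin 2) κ A)))
    (- fromCols (0 : Matrix (Fin 2) (Fin 1) A)
      (fromCols (1 : Matrix (Fin 2) (Fin 2) A) (0 : Matrix (Fin 2) κ A)))
  rw [Matrix.one_mul, add_neg_cancel] at s3
  exact s1.trans (s2.trans s3)

theorem colEquiv_one_zero_one (C : Matrix (Fin 2) κ A) :
    ColEquiv (fromCols (1 : Matrix (Fin 2) (Fin 2) A) 0) (fromCols 1 C) := by
  simpa using colEquiv_fromCols_add_right (1 : Matrix (Fin 2) (Fin 2) A) 0 C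

theorem eq_add_smul_of_map_mk_eq {ρ ι : Type*} {L : A} {M N : Matrix ρ ι A}
    (h : M.map (Ideal.Quotient.mk (Ideal.span {L})) = N.map (Ideal.Quotient.mk (Ideal.span {L}))) :
    ∃ E : Matrix ρ ι A, M = N + L • E := by
  have : ∀ i j, ∃ e, M i j = N i j + L * e := fun i j => by
    have := congrFun (congrFun h i) j
    simp only [Matrix.map_apply] at this
    rw [Ideal.Quotient.eq, Ideal.mem_span_singleton] at this
    obtain ⟨e, he⟩ := this
    exact ⟨e, by rw [← he]; ring⟩
  choose e he using this
  exact ⟨of e, by ext i j; simp [he]⟩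

theorem exists_colEquiv_congr (I : Ideal A) (M : Matrix (Fin 2) (Fin 2 ⊕ κ) A)
    (hB : I ⊔ rowIdeal M (rightCols κ) = ⊤)
    (hF : I ⊔ minorIdeal M (insert (Sum.inl 1) (rightCols κ)) = ⊤) (C : Matrix (Fin 2) κ A) :
    ∃ (X : Matrix (Fin 2) (Fin 2) A) (S : Matrix (Fin 2) κ A), ColEquiv M (fromCols X S) ∧
      X.det - 1 ∈ I ∧ S.map (Ideal.Quotient.mk I) = C.map (Ideal.Quotient.mk I) := by
  obtain ⟨M', hM, hM'⟩ := ColEquiv.exists_lift Ideal.Quotient.mk_surjective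
    ((colEquiv_map_mk_fromCols_one_zero I M hB hF).trans (colEquiv_one_zero_one
      (C.map (Ideal.Quotient.mk I))))
  refine ⟨M'.toCols₁, M'.toCols₂, by simpa using hM, ?_, ?_⟩
  · rw [← Ideal.Quotient.eq, RingHom.map_det, map_one]
    have : (Ideal.Quotient.mk I).mapMatrix M'.toCols₁ = 1 := by
      ext i j
      have := congrFun (congrFun hM' i) (Sum.inl j)
      simpa using this
    rw [this, det_one]
  · ext i j
    have := congrFun (congrFun hM' i) (Sum.inr j)
    simpa using this

theorem span_singleton_sup_eq_top {I J : Ideal A} {g : A} (hg : g - 1 ∈ J) (h : J ≤ I) :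
    Ideal.span {g} ⊔ I = ⊤ := by
  rw [Ideal.eq_top_iff_one]
  have h1 : g ∈ Ideal.span {g} ⊔ I := Ideal.mem_sup_left (Ideal.mem_span_singleton_self _)
  have h2 : g - 1 ∈ Ideal.span {g} ⊔ I := Ideal.mem_sup_right (h hg)
  simpa using sub_mem h1 h2

theorem exists_comaximal_blocks [IsNoetherianRing A] {d : ℕ} (hd : ringKrullDim A ≤ d)
    (hdn : d < 2 * (3 + Fintype.card κ))
    (M N : Matrix (Fin 2) (Fin 2 ⊕ (Fin 1 ⊕ (Fin 2 ⊕ κ))) A)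
    (hM : ∃ U : Matrix (Fin 2 ⊕ (Fin 1 ⊕ (Fin 2 ⊕ κ))) (Fin 2) A, M * U = 1)
    (hN : ∃ U : Matrix (Fin 2 ⊕ (Fin 1 ⊕ (Fin 2 ⊕ κ))) (Fin 2) A, N * U = 1) :
    ∃ (X Y W W' : Matrix (Fin 2) (Fin 2) A) (s s' : Matrix (Fin 2) (Fin 1) A)
      (T T' : Matrix (Fin 2) κ A) (g : A),
      ColEquiv M (fromCols X (fromCols s (fromCols W T))) ∧
      ColEquiv N (fromCols Y (fromCols s' (fromCols W' T'))) ∧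
      s 0 0 ^ 2 * W.det - 1 = Y.det * g := by
  obtain ⟨M1, hM1, hB1, hF1⟩ := exists_general_position_rightCols ⊥ (codimGE_bot hd) M hM
  rw [bot_sup_eq] at hB1 hF1
  obtain ⟨N1, hN1, hB2, hF2⟩ := exists_general_position_rightCols _ (hB1.mul hF1) N hN
  have hc : Fintype.card (Fin 1 ⊕ (Fin 2 ⊕ κ)) = 3 + Fintype.card κ := by
    simp; omega
  rw [hc] at hB2 hF2
  obtain ⟨Y, S', hY, hdet, -⟩ := exists_colEquiv_congr _ N1 (hB2.eq_top (by omega))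
    (hF2.eq_top (by omega)) 0
  obtain ⟨C, hC1, hC2⟩ : ∃ C : Matrix (Fin 2) (Fin 1 ⊕ (Fin 2 ⊕ κ)) A, C 0 (Sum.inl 0) = 1 ∧
      ∀ a b, C a (Sum.inr (Sum.inl b)) = (1 : Matrix (Fin 2) (Fin 2) A) a b :=
    ⟨fromCols (of fun _ _ => 1) (fromCols 1 0), rfl, fun _ _ => rfl⟩
  have hB3 := span_singleton_sup_eq_top hdet Ideal.mul_le_left
  have hF3 := span_singleton_sup_eq_top hdet Ideal.mul_le_right
  obtain ⟨X, S, hX, -, hS⟩ := exists_colEquiv_congr (Ideal.span {Y.det}) M1 hB3 hF3 C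
  have hj : S 0 (Sum.inl 0) - 1 ∈ Ideal.span {Y.det} := by
    have := congrFun (congrFun hS 0) (Sum.inl 0)
    rw [← Ideal.Quotient.eq]
    simpa [hC1] using this
  have hJ : (S.toCols₂.toCols₁).det - 1 ∈ Ideal.span {Y.det} := by
    rw [← Ideal.Quotient.eq, RingHom.map_det, map_one]
    have : (Ideal.Quotient.mk (Ideal.span {Y.det})).mapMatrix (S.toCols₂.toCols₁) = 1 := by
      ext a b
      have := congrFun (congrFun hS a) (Sum.inr (Sum.inl b))
      simp only [Matrix.map_apply] at this
      rw [RingHom.mapMatrix_apply, Matrix.map_apply, toCols₁_apply, toCols₂_apply, this, hC2]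
      rw [Matrix.one_apply, Matrix.one_apply]
      split_ifs <;> simp
    rw [this, det_one]
  obtain ⟨a, ha⟩ := Ideal.mem_span_singleton.1 hj
  obtain ⟨b, hb⟩ := Ideal.mem_span_singleton.1 hJ
  refine ⟨X, Y, S.toCols₂.toCols₁, S'.toCols₂.toCols₁, S.toCols₁, S'.toCols₁, S.toCols₂.toCols₂,
    S'.toCols₂.toCols₂, a * (S 0 (Sum.inl 0) + 1) * (S.toCols₂.toCols₁).det + b, ?_, ?_, ?_⟩
  · simpa using hM1.trans hX
  · simpa using hN1.trans hY
  · rw [toCols₁_apply]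
    linear_combination (S 0 (Sum.inl 0) + 1) * (S.toCols₂.toCols₁).det * ha + hb

theorem exists_colEquiv_congr_of_isUnit_det {L g : A} (Y W : Matrix (Fin 2) (Fin 2) A)
    (s : Matrix (Fin 2) (Fin 1) A) (T : Matrix (Fin 2) κ A) (h : L - 1 = Y.det * g) (x : A) :
    ∃ (E : Matrix (Fin 2) (Fin 2) A) (S : Matrix (Fin 2) (Fin 1 ⊕ (Fin 2 ⊕ κ)) A) (c : A),
      ColEquiv (fromCols Y (fromCols s (fromCols W T))) (fromCols (1 + L • E) S) ∧
      S 0 (Sum.inl 0) = x + L * c := by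
  set q := Ideal.Quotient.mk (Ideal.span {L}) with hq
  have hqL : q (-(Y.det * g)) = 1 := by
    rw [← map_one q, hq, Ideal.Quotient.eq, Ideal.mem_span_singleton]
    exact ⟨-1, by linear_combination h⟩
  have h1 : Y.map q * (Y.adjugate.map q * (-(q g)) • 1) = 1 := by
    rw [← Matrix.mul_assoc, ← Matrix.map_mul, Matrix.mul_adjugate]
    ext a b
    simp only [Matrix.map_apply, Matrix.smul_apply, smul_eq_mul, map_mul,
      Matrix.one_apply, Matrix.mul_smul, Matrix.mul_one]
    rw [map_neg, map_mul] at hqL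
    split_ifs
    · rw [map_one]; linear_combination hqL
    · simp
  obtain ⟨C, hC⟩ : ∃ C : Matrix (Fin 2) (Fin 1 ⊕ (Fin 2 ⊕ κ)) A, C 0 (Sum.inl 0) = x :=
    ⟨of fun _ _ => x, rfl⟩
  have h2 := (colEquiv_one_zero_of_isUnit h1 (s.map q) (W.map q) (T.map q)).trans
    (colEquiv_one_zero_one (C.map q))
  have h3 : (fromCols Y (fromCols s (fromCols W T))).map q =
      fromCols (Y.map q) (fromCols (s.map q) (fromCols (W.map q) (T.map q))) := by
    simp [fromCols_map]
  rw [← h3] at h2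
  obtain ⟨N, hN, hN'⟩ := ColEquiv.exists_lift Ideal.Quotient.mk_surjective h2
  have h4 : N.map q = (fromCols (1 : Matrix (Fin 2) (Fin 2) A) C).map q := by
    rw [hN']; simp [fromCols_map]
  obtain ⟨E, hE⟩ := eq_add_smul_of_map_mk_eq h4
  refine ⟨E.toCols₁, C + L • E.toCols₂, E 0 (Sum.inr (Sum.inl 0)), ?_, ?_⟩
  · convert hN using 1
    rw [hE]
    ext a (b | b) <;> simp
  · simp [hC]

theorem ColEquiv.add_first_column {X : Matrix (Fin 2) (Fin 2) A}
    {s : Matrix (Fin 2) (Fin 1) A} {T : Matrix (Fin 2) κ A}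
    (c : Fin 2 → A) : ColEquiv (fromCols X (fromCols s T))
      (fromCols (X + vecMulVec (fun r => s r 0) c) (fromCols s T)) := by
  have := colEquiv_fromCols_add_left X (fromCols s T)
    (fromRows (of fun _ => c) (0 : Matrix κ (Fin 2) A))
  rw [fromCols_mul_fromRows, Matrix.mul_zero, add_zero] at this
  convert this using 3
  ext a b
  simp [Matrix.mul_apply, vecMulVec]

/-- Simultaneous normal form for two right invertible matrices `(X | S)`, `(Y | S')`. -/
theorem exists_simultaneous_normal_form [IsNoetherianRing A] {d : ℕ} (hd : ringKrullDim A ≤ d)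
    (hdn : d < 2 * (3 + Fintype.card κ))
    (M N : Matrix (Fin 2) (Fin 2 ⊕ (Fin 1 ⊕ (Fin 2 ⊕ κ))) A)
    (hM : ∃ U : Matrix (Fin 2 ⊕ (Fin 1 ⊕ (Fin 2 ⊕ κ))) (Fin 2) A, M * U = 1)
    (hN : ∃ U : Matrix (Fin 2 ⊕ (Fin 1 ⊕ (Fin 2 ⊕ κ))) (Fin 2) A, N * U = 1) :
    ∃ (X Y G : Matrix (Fin 2) (Fin 2) A) (S S' : Matrix (Fin 2) (Fin 1 ⊕ (Fin 2 ⊕ κ)) A)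
      (e e' f : Fin 2 → A),
      ColEquiv M (fromCols X S) ∧ ColEquiv N (fromCols Y S') ∧
      S 0 (Sum.inl 0) + S' 0 (Sum.inl 0) = 1 ∧ X = 1 + Y.det • G ∧
      X 0 = ![1, 0] + (S' 0 (Sum.inl 0) * Y.det) • e ∧
      Y 0 = ![1, 0] + S 0 (Sum.inl 0) • e' ∧
      X 0 ᵥ* Y = X 0 + S 0 (Sum.inl 0) • f := by
  obtain ⟨X, Y, W, W', s, s', T, T', g, hMX, hNY, hg⟩ := exists_comaximal_blocks hd hdn M N hM hN
  obtain ⟨F, S', c, hY', hk⟩ := exists_colEquiv_congr_of_isUnit_det Y W' s' T' hg (1 - s 0 0)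
  set j := s 0 0 with hj
  set J := W.det with hJ
  set ρ := 1 - j * J * c with hρ
  -- column three of the first matrix
  have m1 := colEquiv_fromCols_right X (colEquiv_fromCols_add_left s (fromCols W T)
    (fromRows (W.adjugate * of ![![-(j ^ 2 * c)], ![0]]) 0))
  rw [fromCols_mul_fromRows, Matrix.mul_zero, add_zero, ← Matrix.mul_assoc, Matrix.mul_adjugate,
    ← hJ] at m1
  set t : Matrix (Fin 2) (Fin 1) A :=
    s + J • (1 : Matrix (Fin 2) (Fin 2) A) * of ![![-(j ^ 2 * c)], ![0]]
    with ht
  have ht0 : t 0 0 = j * ρ := by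
    simp [ht, ← hj, hρ]; ring
  -- the left block of the second matrix
  have n1 := ColEquiv.add_first_column (X := 1 + (j ^ 2 * J) • F) (s := S'.toCols₁)
    (T := S'.toCols₂)
    (-((j ^ 2 * J) • F 0))
  rw [fromCols_toCols] at n1
  obtain ⟨F₁, hF₁⟩ : ∃ F₁, F₁ = j • (F - vecMulVec (fun r => S'.toCols₁ r 0) (F 0)) := ⟨_, rfl⟩
  have hYF : 1 + (j ^ 2 * J) • F + vecMulVec (fun r => S'.toCols₁ r 0) (-((j ^ 2 * J) • F 0)) =
      1 + (j * J) • F₁ := by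
    rw [hF₁]; ext a b; simp [vecMulVec]; ring
  rw [hYF] at n1
  obtain ⟨Y₁, hY₁⟩ : ∃ Y₁, Y₁ = 1 + (j * J) • F₁ := ⟨_, rfl⟩
  rw [← hY₁] at n1
  obtain ⟨h₀, hh₀⟩ : ∃ h₀, Y₁.det = 1 + j * J * h₀ :=
    ⟨F₁ 0 0 + F₁ 1 1 + j * J * F₁.det, by rw [hY₁]; simp [det_fin_two]; ring⟩
  have hδ : Y₁.det * ρ = 1 + J * (j * h₀ - j * c - j ^ 2 * J * h₀ * c) := by
    rw [hh₀, hρ]; ring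
  have hY0 : Y₁ 0 = ![1, 0] + (j * ρ) • (j ^ 2 * J) • F 0 := by
    rw [hY₁, hF₁]; ext b
    have h3 : S' 0 (Sum.inl 0) = 1 - j * ρ := by rw [hk, hρ]; ring
    fin_cases b <;> simp [vecMulVec, h3] <;> ring
  -- the left block of the first matrix
  obtain ⟨E, hE⟩ : ∃ E, E = X - 1 := ⟨_, rfl⟩
  obtain ⟨h, hh⟩ : ∃ h, h = j * h₀ - j * c - j ^ 2 * J * h₀ * c := ⟨_, rfl⟩
  rw [← hh] at hδ
  have m2 := colEquiv_fromCols_add_left X (fromCols t (fromCols W T))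
    (fromRows (0 : Matrix (Fin 1) (Fin 2) A) (fromRows (W.adjugate * (h • E)) 0))
  rw [fromCols_mul_fromRows, fromCols_mul_fromRows, Matrix.mul_zero, Matrix.mul_zero, add_zero,
    zero_add, ← Matrix.mul_assoc, Matrix.mul_adjugate, ← hJ] at m2
  have hX2 : X + J • (1 : Matrix (Fin 2) (Fin 2) A) * h • E = 1 + (Y₁.det * ρ) • E := by
    rw [hδ, hE]; ext a b; simp; ring
  rw [hX2] at m2
  have m3 := ColEquiv.add_first_column (X := 1 + (Y₁.det * ρ) • E) (s := t) (T := fromCols W T)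
    (-((Y₁.det * ρ) • E 0))
  have hX3 : 1 + (Y₁.det * ρ) • E + vecMulVec (fun r => t r 0) (-((Y₁.det * ρ) • E 0)) =
      1 + Y₁.det • ρ • (E - vecMulVec (fun r => t r 0) (E 0)) := by
    ext a b; simp [vecMulVec]; ring
  rw [hX3] at m3
  have hk' : S' 0 (Sum.inl 0) = 1 - j * ρ := by rw [hk, hρ]; ring
  have hX0 : (1 + Y₁.det • ρ • (E - vecMulVec (fun r => t r 0) (E 0))) 0 =
      ![1, 0] + (S' 0 (Sum.inl 0) * Y₁.det) • ρ • E 0 := by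
    rw [hk']; ext b
    fin_cases b <;> simp [vecMulVec, ht0] <;> ring
  refine ⟨_, Y₁, _, fromCols t (fromCols W T), S', ρ • E 0, (j ^ 2 * J) • F 0,
    (j ^ 2 * J) • F 0 + (Y₁.det * S' 0 (Sum.inl 0) * J) • E 0 ᵥ* F₁,
    hMX.trans (m1.trans (m2.trans m3)), hNY.trans (hY'.trans n1), ?_, rfl, hX0, ?_, ?_⟩
  · simp [ht0, hk']
  · simpa [ht0] using hY0
  · rw [hX0]
    have h5 : (![1, 0] : Fin 2 → A) ᵥ* Y₁ = Y₁ 0 := by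
      ext b; simp [vecMul, dotProduct, Fin.sum_univ_two]
    rw [add_vecMul, h5, hY0, hY₁]
    ext b
    simp only [vecMul_add, vecMul_smul, smul_vecMul, ht0, Pi.add_apply, Pi.smul_apply, smul_eq_mul,
      vecMul_one, fromCols_apply_inl]
    ring

end NormalForm

section Symbol
variable {A : Type*} [CommRing A] {ι : Type*} [Fintype ι] [DecidableEq ι] {G : Type*} [CommGroup G]

/-- A map on rows that is constant on elementary orbits of unimodular rows and is multiplicative,
in the coordinate `o`, on pairs of complementary elements. -/
structure IsSymbol (φ : (ι → A) → G) (o : ι) : Prop where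
  map_eq : ∀ {v w : ι → A}, Unim v → RowEquiv v w → φ v = φ w
  map_mul : ∀ (x y : A) (a : ι → A), x + y = 1 → Unim (Function.update a o x) →
    Unim (Function.update a o y) → φ (Function.update a o (x * y)) =
      φ (Function.update a o x) * φ (Function.update a o y)

end Symbol

section Product
variable {A : Type*} [CommRing A] {κ : Type*} [Fintype κ] [DecidableEq κ]
  {G : Type*} [CommGroup G]

theorem mem_span_vecMul {x e : Fin 2 → A} {Y : Matrix (Fin 2) (Fin 2) A} {k g : A}
    (hx : x 0 = 1 + k * Y.det * e 0) (h1 : g ∈ Ideal.span {Y.det})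
    (h2 : g ∈ Ideal.span {x 0, x 1}) (I : Ideal A) (hI : ∀ i, (x ᵥ* Y) i ∈ I) : g ∈ I := by
  obtain ⟨u, rfl⟩ := Ideal.mem_span_singleton.1 h1
  obtain ⟨α, β, h⟩ := Ideal.mem_span_pair.1 h2
  have h0 := hI 0
  have h1 := hI 1
  simp only [vecMul, dotProduct, Fin.sum_univ_two] at h0 h1
  have e0 : x 0 * Y.det ∈ I := by
    have := sub_mem (I.mul_mem_left (Y 1 1) h0) (I.mul_mem_left (Y 1 0) h1)
    convert this using 1
    rw [det_fin_two]; ring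
  have e1 : x 1 * Y.det ∈ I := by
    have := sub_mem (I.mul_mem_left (Y 0 0) h1) (I.mul_mem_left (Y 0 1) h0)
    convert this using 1
    rw [det_fin_two]; ring
  have : Y.det * u = u * (x 0 * Y.det) - k * e 0 * (α * (x 0 * Y.det) + β * (x 1 * Y.det)) := by
    linear_combination Y.det * k * e 0 * h - Y.det * u * hx
  rw [this]
  exact sub_mem (I.mul_mem_left _ e0) (I.mul_mem_left _ (add_mem (I.mul_mem_left _ e0)
    (I.mul_mem_left _ e1)))

theorem IsSymbol.map_product_row {φ : (Fin 2 ⊕ (Fin 1 ⊕ (Fin 2 ⊕ κ)) → A) → G}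
    (hφ : IsSymbol φ (Sum.inr (Sum.inl 0))) {x e e' f : Fin 2 → A}
    {Y : Matrix (Fin 2) (Fin 2) A} {s s' : Fin 1 ⊕ (Fin 2 ⊕ κ) → A}
    (D : Matrix (Fin 2) (Fin 1 ⊕ (Fin 2 ⊕ κ)) A)
    (hv : Unim (Sum.elim x s)) (hw : Unim (Sum.elim (Y 0) s'))
    (hz : Unim (Sum.elim (x ᵥ* Y) (s + x ᵥ* D)))
    (hjk : s (Sum.inl 0) + s' (Sum.inl 0) = 1)
    (hx : x = ![1, 0] + (s' (Sum.inl 0) * Y.det) • e)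
    (hy : Y 0 = ![1, 0] + s (Sum.inl 0) • e')
    (hxY : x ᵥ* Y = x + s (Sum.inl 0) • f)
    (hD : D 0 = s' - s) :
    φ (Sum.elim (x ᵥ* Y) (s + x ᵥ* D)) = φ (Sum.elim x s) * φ (Sum.elim (Y 0) s') := by
  obtain ⟨j, hj⟩ : ∃ j, j = s (Sum.inl 0) := ⟨_, rfl⟩
  obtain ⟨k, hk⟩ : ∃ k, k = s' (Sum.inl 0) := ⟨_, rfl⟩
  obtain ⟨z, hz'⟩ : ∃ z, z = x ᵥ* Y := ⟨_, rfl⟩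
  obtain ⟨q, hq⟩ : ∃ q, q = s + x ᵥ* D := ⟨_, rfl⟩
  rw [← hj, ← hk] at hjk
  rw [← hk] at hx
  rw [← hj] at hxY hy
  rw [← hz', ← hq] at hz ⊢
  rw [← hz'] at hxY
  have hx0 : x 0 = 1 + k * Y.det * e 0 := by simpa using congrFun hx 0
  have hx1 : x 1 = k * Y.det * e 1 := by simpa using congrFun hx 1
  have hy0 : Y 0 0 = 1 + j * e' 0 := by rw [hy]; simp
  have hy1 : Y 0 1 = j * e' 1 := by rw [hy]; simp
  have hzx : ∀ i, z i = x i + j * f i := fun i => by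
    simpa using congrFun hxY i
  have hzy : ∀ i, z i = Y 0 i + k * (Y.det * (e ᵥ* Y) i) := fun i => by
    rw [hz']
    simp only [vecMul, dotProduct, Fin.sum_univ_two, hx0, hx1]; ring
  have hqs : ∀ i, q i = s i + (x 0 * D 0 i + x 1 * D 1 i) := fun i => by
    rw [hq]; simp [vecMul, dotProduct, Fin.sum_univ_two]
  have hqs' : ∀ i, q i = s' i + k * (Y.det * (e ᵥ* D) i) := fun i => by
    have h0 : D 0 i = s' i - s i := by rw [hD]; simp
    rw [hqs i]
    simp only [vecMul, dotProduct, Fin.sum_univ_two, hx0, hx1, h0]; ring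
  obtain ⟨a, ha⟩ : ∃ a, a = k * (1 - x 0) + j * x 0 := ⟨_, rfl⟩
  obtain ⟨b, hb⟩ : ∃ b, b = -(Y.det * e 0 * (1 - x 0)) - e' 0 * x 0 := ⟨_, rfl⟩
  let c : Fin 2 ⊕ (Fin 1 ⊕ (Fin 2 ⊕ κ)) := Sum.inr (Sum.inl 0)
  let l : Fin 2 ⊕ (Fin 1 ⊕ (Fin 2 ⊕ κ)) := Sum.inr (Sum.inr (Sum.inl 0))
  let r : Fin 2 ⊕ (Fin 1 ⊕ (Fin 2 ⊕ κ)) → A := Sum.elim z q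
  have hcl : l ≠ c := fun h => by injection h with h; cases h
  obtain ⟨r', hr'⟩ : ∃ r', r' = Function.update r l (r l * b) := ⟨_, rfl⟩
  let T : Set (Fin 2 ⊕ (Fin 1 ⊕ (Fin 2 ⊕ κ))) := {Sum.inl 0, Sum.inl 1, c}
  have key : ∀ (p : Fin 2 → A) (t : Fin 1 ⊕ (Fin 2 ⊕ κ) → A),
      (∀ i, z i - p i ∈ Ideal.span {t (Sum.inl 0)}) →
      (∀ I : Ideal A, (∀ i, z i ∈ I) → t (Sum.inl 0) ∈ I → (∀ i, q i - t i ∈ I) ∧ b - 1 ∈ I) →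
      RowEquiv (Sum.elim p t) (Function.update r' c (t (Sum.inl 0))) := by
    intro p t h1 h2
    have s1 : RowEquiv (Sum.elim p t) (Sum.elim z t) := by
      refine rowEquiv_of_sub_mem_span {c} (by rintro _ rfl; rfl) ?_
      rintro (i | i) _
      · simpa [c] using h1 i
      · simp
    refine s1.trans (rowEquiv_of_sub_mem_span T ?_ ?_)
    · rintro i (rfl | rfl | rfl)
      · rw [Function.update_of_ne (by simp [c]), hr', Function.update_of_ne (by simp [l])]; rfl
      · rw [Function.update_of_ne (by simp [c]), hr', Function.update_of_ne (by simp [l])]; rfl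
      · rw [Function.update_self]; rfl
    · intro i hi
      obtain ⟨I, hI⟩ : ∃ I, I = Ideal.span ((Sum.elim z t) '' T) := ⟨_, rfl⟩
      have hzI : ∀ i, z i ∈ I := fun i => by
        rw [hI]
        refine Ideal.subset_span ⟨Sum.inl i, ?_, rfl⟩
        fin_cases i <;> simp [T]
      have htI : t (Sum.inl 0) ∈ I := by
        rw [hI]
        exact Ideal.subset_span ⟨c, by simp [T], rfl⟩
      obtain ⟨h3, h4⟩ := h2 I hzI htI
      rw [← hI]
      by_cases hil : i = l
      · subst hil
        have : Function.update r' c (t (Sum.inl 0)) l - Sum.elim z t l =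
            (q (Sum.inr (Sum.inl 0)) - t (Sum.inr (Sum.inl 0))) * b +
              t (Sum.inr (Sum.inl 0)) * (b - 1) := by
          rw [Function.update_of_ne hcl, hr', Function.update_self]
          simp [r, l]; ring
        rw [this]
        exact add_mem (I.mul_mem_right _ (h3 _)) (I.mul_mem_left _ h4)
      · have hic : i ≠ c := fun h => hi (by simp [T, h])
        rw [Function.update_of_ne hic, hr', Function.update_of_ne hil]
        rcases i with i | i
        · simp [r]
        · simpa [r] using h3 i
  have kv : RowEquiv (Sum.elim x s) (Function.update r' c j) := by
    rw [hj]
    refine key x s (fun i => ?_) fun I hzI hI => ?_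
    · rw [← hj, hzx, Ideal.mem_span_singleton]; exact ⟨f i, by ring⟩
    · rw [← hj] at hI
      have hxI : ∀ i, x i ∈ I := fun i => by
        have := sub_mem (hzI i) (I.mul_mem_right (f i) hI)
        rwa [hzx, add_sub_cancel_right] at this
      refine ⟨fun i => ?_, ?_⟩
      · rw [hqs, add_sub_cancel_left]
        exact add_mem (I.mul_mem_right _ (hxI 0)) (I.mul_mem_right _ (hxI 1))
      · have : b - 1 = (x 0 - 2 - e' 0) * x 0 - Y.det * e 0 * (1 - x 0) * j := by
          rw [hb]; linear_combination (-(x 0) + 1) * hx0 + Y.det * e 0 * (1 - x 0) * hjk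
        rw [this]
        exact sub_mem (I.mul_mem_left _ (hxI 0)) (I.mul_mem_left _ hI)
  have kw : RowEquiv (Sum.elim (Y 0) s') (Function.update r' c k) := by
    rw [hk]
    refine key (Y 0) s' (fun i => ?_) fun I hzI hI => ?_
    · rw [← hk, hzy, Ideal.mem_span_singleton]; exact ⟨Y.det * (e ᵥ* Y) i, by ring⟩
    · rw [← hk] at hI
      have hyI : ∀ i, Y 0 i ∈ I := fun i => by
        have := sub_mem (hzI i) (I.mul_mem_right (Y.det * (e ᵥ* Y) i) hI)
        rwa [hzy, add_sub_cancel_right] at this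
      refine ⟨fun i => ?_, ?_⟩
      · rw [hqs', add_sub_cancel_left]
        exact I.mul_mem_right _ hI
      · have : b - 1 = k * ((Y.det * e 0) ^ 2 - e' 0 - e' 0 * Y.det * e 0) - Y 0 0 := by
          rw [hb, hx0, hy0]; linear_combination e' 0 * hjk
        rw [this]
        exact sub_mem (I.mul_mem_right _ hI) (hyI 0)
  have kz : RowEquiv r (Function.update r' c (j * k)) := by
    have hzI : ∀ i, (x ᵥ* Y) i ∈ Ideal.span (r '' {Sum.inl 0, Sum.inl 1}) := fun i => by
      refine Ideal.subset_span ⟨Sum.inl i, ?_, by simp [r, hz']⟩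
      fin_cases i <;> simp
    have hab : a * b - 1 + z 0 ∈ Ideal.span (r '' {Sum.inl 0, Sum.inl 1}) := by
      have hz0 : z 0 = x 0 * Y 0 0 + x 1 * Y 1 0 := by
        rw [hz']; simp [vecMul, dotProduct, Fin.sum_univ_two]
      refine mem_span_vecMul hx0 ?_ ?_ _ hzI
      · refine Ideal.mem_span_singleton.2 ⟨j * (Y.det * e 0 * (k * e 0) - e' 0 * (k * e 0)) +
          (j * (k * e 0) - k * (k * e 0)) * b + k * e 0 * Y 0 0 + k * e 1 * Y 1 0, ?_⟩
        rw [hz0, ha, hb, hx0, hx1, hy0]; ring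
      · refine Ideal.mem_span_pair.2 ⟨-1 + (j - k) * (-(Y.det * e 0)) +
          k * (Y.det * e 0 - e' 0) + x 0 * (j - k) * (Y.det * e 0 - e' 0) + Y 0 0, Y 1 0, ?_⟩
        rw [hz0, ha, hb]; linear_combination -hx0
    have hqa : j * k - q (Sum.inl 0) * a ∈ Ideal.span (r '' {Sum.inl 0, Sum.inl 1}) := by
      refine mem_span_vecMul hx0 ?_ ?_ _ hzI
      · refine Ideal.mem_span_singleton.2
          ⟨-(k * (e ᵥ* D) (Sum.inl 0) * a + k * (k * e 0) * (j - k)), ?_⟩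
        rw [hqs', ← hk, ha, hx0]; ring
      · refine Ideal.mem_span_pair.2
          ⟨-(D 0 (Sum.inl 0) * a + j * (j - k)), -(D 1 (Sum.inl 0) * a), ?_⟩
        rw [hqs, ← hj, ha]; ring
    have s1 : RowEquiv r (Function.update r' c (r c * a)) := by
      refine rowEquiv_scale c l hcl.symm {Sum.inl 0, Sum.inl 1} (by simp [c]) (by simp [l]) a b ?_
        ?_ ?_ ?_
      · have := sub_mem hab (hz' ▸ hzI 0)
        simpa using this
      · intro i h1 h2
        rw [Function.update_of_ne h1, hr', Function.update_of_ne h2]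
      · simp
      · rw [Function.update_of_ne hcl, hr', Function.update_self]
    refine s1.trans (rowEquiv_change c {Sum.inl 0, Sum.inl 1} (by simp [c]) ?_ ?_)
    · intro i hi
      rw [Function.update_of_ne hi, Function.update_of_ne hi]
    · rw [Function.update_self, Function.update_self]
      refine Ideal.span_mono ?_ hqa
      rintro _ ⟨i, hi, rfl⟩
      refine ⟨i, hi, ?_⟩
      rcases hi with rfl | rfl <;> simp [hr', c, l]
  have := hφ.map_mul j k r' hjk (kv.unim hv) (kw.unim hw)
  rw [hφ.map_eq hz kz, hφ.map_eq hv kv, hφ.map_eq hw kw]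
  exact this

theorem exists_right_inverse_product {X Y B : Matrix (Fin 2) (Fin 2) A} {τ : Type*} [Fintype τ]
    [DecidableEq τ] {S S' : Matrix (Fin 2) τ A} (hX : X = 1 + Y.det • B)
    (hM : ∃ U : Matrix (Fin 2 ⊕ τ) (Fin 2) A, fromCols X S * U = 1)
    (hN : ∃ U : Matrix (Fin 2 ⊕ τ) (Fin 2) A, fromCols Y S' * U = 1) :
    ∃ U : Matrix (Fin 2 ⊕ τ) (Fin 2) A, fromCols (X * Y) (S + X * (S' - S)) * U = 1 := by
  obtain ⟨K, hK⟩ := hM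
  obtain ⟨L, hL⟩ := hN
  rw [← fromRows_toRows K, fromCols_mul_fromRows] at hK
  rw [← fromRows_toRows L, fromCols_mul_fromRows] at hL
  obtain ⟨K₁, hK₁⟩ : ∃ K₁, K₁ = K.toRows₁ := ⟨_, rfl⟩
  obtain ⟨K₂, hK₂⟩ : ∃ K₂, K₂ = K.toRows₂ := ⟨_, rfl⟩
  obtain ⟨L₁, hL₁⟩ : ∃ L₁, L₁ = L.toRows₁ := ⟨_, rfl⟩
  obtain ⟨L₂, hL₂⟩ : ∃ L₂, L₂ = L.toRows₂ := ⟨_, rfl⟩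
  rw [← hK₁, ← hK₂] at hK
  rw [← hL₁, ← hL₂] at hL
  have h1 : fromCols (X * Y) (S + X * (S' - S)) * fromRows L₁ L₂ =
      1 + Y.det • (B - B * (S * L₂)) := by
    have e1 : X * Y * L₁ + (S + X * (S' - S)) * L₂ =
        X * (Y * L₁ + S' * L₂) + (1 - X) * (S * L₂) := by
      simp only [Matrix.add_mul, Matrix.mul_sub, Matrix.sub_mul, Matrix.mul_add, Matrix.mul_assoc,
        Matrix.one_mul]
      abel
    rw [fromCols_mul_fromRows, e1, hL, hX]
    simp only [Matrix.mul_one, sub_add_cancel_left, Matrix.neg_mul, smul_sub, Matrix.smul_mul]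
    abel
  have h2 : fromCols (X * Y) (S + X * (S' - S)) *
      fromRows (Y.adjugate * (K₁ - (S' - S) * K₂)) (Y.det • K₂) = Y.det • 1 := by
    have e1 : X * Y * (Y.adjugate * (K₁ - (S' - S) * K₂)) =
        Y.det • (X * (K₁ - (S' - S) * K₂)) := by
      rw [Matrix.mul_assoc, ← Matrix.mul_assoc Y, Matrix.mul_adjugate, Matrix.smul_mul,
        Matrix.one_mul, Matrix.mul_smul]
    rw [fromCols_mul_fromRows, e1, Matrix.mul_smul, ← smul_add, ← hK]
    congr 1
    simp only [Matrix.add_mul, Matrix.mul_sub, Matrix.sub_mul, Matrix.mul_assoc]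
    abel
  refine ⟨fromRows L₁ L₂ - fromRows (Y.adjugate * (K₁ - (S' - S) * K₂)) (Y.det • K₂) *
    (B - B * (S * L₂)), ?_⟩
  rw [Matrix.mul_sub, h1, ← Matrix.mul_assoc (fromCols _ _), h2, Matrix.smul_mul, Matrix.one_mul,
    add_sub_cancel_right]

theorem unim_of_exists_right_inverse {ι : Type*} [Fintype ι] [DecidableEq ι]
    {M : Matrix (Fin 2) ι A} (h : ∃ U : Matrix ι (Fin 2) A, M * U = 1) (i : Fin 2) :
    Unim (M i) := by
  obtain ⟨U, hU⟩ := h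
  refine unim_iff.2 ⟨fun j => U j i, ?_⟩
  have := congrFun (congrFun hU i) i
  simpa [Matrix.mul_apply, dotProduct] using this

/-- First rows of right invertible matrices with two rows are closed under products. -/
theorem IsSymbol.exists_map_mul [IsNoetherianRing A] {d : ℕ} (hd : ringKrullDim A ≤ d)
    (hdn : d < 2 * (3 + Fintype.card κ)) {φ : (Fin 2 ⊕ (Fin 1 ⊕ (Fin 2 ⊕ κ)) → A) → G}
    (hφ : IsSymbol φ (Sum.inr (Sum.inl 0)))
    (M N : Matrix (Fin 2) (Fin 2 ⊕ (Fin 1 ⊕ (Fin 2 ⊕ κ))) A)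
    (hM : ∃ U : Matrix (Fin 2 ⊕ (Fin 1 ⊕ (Fin 2 ⊕ κ))) (Fin 2) A, M * U = 1)
    (hN : ∃ U : Matrix (Fin 2 ⊕ (Fin 1 ⊕ (Fin 2 ⊕ κ))) (Fin 2) A, N * U = 1) :
    ∃ P : Matrix (Fin 2) (Fin 2 ⊕ (Fin 1 ⊕ (Fin 2 ⊕ κ))) A,
      (∃ U : Matrix (Fin 2 ⊕ (Fin 1 ⊕ (Fin 2 ⊕ κ))) (Fin 2) A, P * U = 1) ∧
      φ (P 0) = φ (M 0) * φ (N 0) := by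
  obtain ⟨X, Y, B, S, S', e, e', f, h1, h2, hjk, hX, hX0, hY0, hXY⟩ :=
    exists_simultaneous_normal_form hd hdn M N hM hN
  have hM' := h1.exists_right_inverse hM
  have hN' := h2.exists_right_inverse hN
  have hP := exists_right_inverse_product hX hM' hN'
  refine ⟨_, hP, ?_⟩
  rw [hφ.map_eq (unim_of_exists_right_inverse hM 0) (h1.row 0),
    hφ.map_eq (unim_of_exists_right_inverse hN 0) (h2.row 0)]
  have hr : ∀ (P : Matrix (Fin 2) (Fin 2) A) (Q : Matrix (Fin 2) (Fin 1 ⊕ (Fin 2 ⊕ κ)) A),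
      fromCols P Q 0 = Sum.elim (P 0) (Q 0) := fun P Q => by ext (i | i) <;> rfl
  have hq : (S + X * (S' - S)) 0 = S 0 + X 0 ᵥ* (S' - S) := by
    ext i; simp [Matrix.mul_apply, vecMul, dotProduct]
  have hz : (X * Y) 0 = X 0 ᵥ* Y := by
    ext i; simp [Matrix.mul_apply, vecMul, dotProduct]
  have h0 := unim_of_exists_right_inverse hP 0
  have h3 := unim_of_exists_right_inverse hM' 0
  have h4 := unim_of_exists_right_inverse hN' 0
  rw [hr] at h0 h3 h4
  rw [hq, hz] at h0
  rw [hr, hr, hr, hq, hz]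
  exact hφ.map_product_row _ h3 h4 h0 hjk hX0 hY0 hXY rfl

end Product

section Square
variable {A : Type*} [CommRing A]

theorem rowEquiv_add_of_dotProduct_eq_zero {ι : Type*} [Fintype ι] [DecidableEq ι] {v c w : ι → A}
    (hv : v ⬝ᵥ c = 1) (hw : w ⬝ᵥ c = 0) (i : ι) (hi : w i = 0) : RowEquiv v (v + w) := by
  have key : ∀ u : ι → A, u ⬝ᵥ c - u i * c i ∈ Ideal.span (u '' {i}ᶜ) := fun u => by
    rw [dotProduct, ← Finset.add_sum_erase _ _ (Finset.mem_univ i), add_sub_cancel_left]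
    refine sum_mem fun k hk => Ideal.mul_mem_right _ _ (Ideal.subset_span ⟨k, ?_, rfl⟩)
    simpa using hk
  obtain ⟨b, hb⟩ : ∃ b, b = v i + (1 - v i * c i) := ⟨_, rfl⟩
  have s1 : RowEquiv v (Function.update v i b) := by
    refine rowEquiv_change i {i}ᶜ (by simp) (fun k hk => by simp [hk]) ?_
    have := key v
    rw [hv] at this
    simpa [hb] using this
  have s2 : RowEquiv (Function.update v i b) (Function.update v i b + b • w) := by
    refine rowEquiv_of_sub_mem_span {i} (by rintro _ rfl; simp [hi]) fun k _ => ?_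
    simpa using Ideal.mul_mem_right _ _ (Ideal.mem_span_singleton_self b)
  have s3 : RowEquiv (Function.update v i b + b • w) (Function.update (v + b • w) i (v i)) := by
    refine rowEquiv_change i {i}ᶜ (by simp) (fun k hk => by simp [hk]) ?_
    have h1 := key (v + b • w)
    rw [add_dotProduct, smul_dotProduct, hv, hw] at h1
    have h2 : (Function.update v i b + b • w) '' {i}ᶜ = (v + b • w) '' {i}ᶜ := by
      refine Set.image_congr fun k hk => ?_
      have : k ≠ i := by simpa using hk
      simp [this]
    rw [h2]
    have h3 := neg_mem h1
    convert h3 using 1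
    simp [hi, hb]
  have s4 : RowEquiv (Function.update (v + b • w) i (v i)) (v + w) := by
    refine rowEquiv_of_sub_mem_span {i} (by rintro _ rfl; simp [hi]) fun k hk => ?_
    have hk : k ≠ i := by simpa using hk
    rw [Set.image_singleton, Function.update_self, Ideal.mem_span_singleton]
    refine ⟨(c i - 1) * w k, ?_⟩
    simp [hk, hb]; ring
  exact s1.trans (s2.trans (s3.trans s4))

/-- The alternating matrix of size four with blocks `a`, `P`, `c`. -/
def altMatrix (a c : A) (P : Matrix (Fin 2) (Fin 2) A) : Matrix (Fin 2 ⊕ Fin 2) (Fin 2 ⊕ Fin 2) A :=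
  fromBlocks (a • !![0, 1; -1, 0]) P (-Pᵀ) (c • !![0, 1; -1, 0])

theorem rowEquiv_altMatrix_upper {a c : A} {P : Matrix (Fin 2) (Fin 2) A} (h : a * c - P.det = 1)
    (Λ : Matrix (Fin 2) (Fin 2) A) :
    ∃ a' P', a' * c - P'.det = 1 ∧
      fromBlocks 1 Λ 0 1 * altMatrix a c P * (fromBlocks 1 Λ 0 1)ᵀ = altMatrix a' c P' ∧
      RowEquiv ![a, P 0 0, P 0 1] ![a', P' 0 0, P' 0 1] := by
  refine ⟨a + (P 0 0 * Λ 1 0 + P 0 1 * Λ 1 1 - Λ 0 0 * P 1 0 - Λ 0 1 * P 1 1) + c * Λ.det,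
    P + c • (Λ * !![0, 1; -1, 0]), ?_, ?_, ?_⟩
  · rw [det_fin_two] at h ⊢
    simp [det_fin_two, Matrix.mul_apply, Fin.sum_univ_two]
    linear_combination h
  · rw [altMatrix, altMatrix, fromBlocks_transpose, fromBlocks_multiply, fromBlocks_multiply]
    congr 1 <;> ext i j <;> fin_cases i <;> fin_cases j <;>
      simp [det_fin_two, Matrix.mul_apply, vecMul, dotProduct, Fin.sum_univ_two] <;> ring
  · have h1 : RowEquiv ![a, P 0 0, P 0 1]
        (![a, P 0 0, P 0 1] + ![-(-Λ 0 1 * -P 1 1), c * -Λ 0 1, 0]) := by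
      refine rowEquiv_add_of_dotProduct_eq_zero (c := ![c, -P 1 1, P 1 0]) ?_ ?_ 2 (by simp)
      · simp [dotProduct, Fin.sum_univ_three]; rw [← h, det_fin_two]; ring
      · simp [dotProduct, Fin.sum_univ_three]; ring
    have h2 := rowEquiv_add_of_dotProduct_eq_zero
      (v := ![a, P 0 0, P 0 1] + ![-(-Λ 0 1 * -P 1 1), c * -Λ 0 1, 0])
      (w := ![-(Λ 0 0 * P 1 0), 0, c * Λ 0 0]) (c := ![c, -P 1 1, P 1 0]) (by
        simp [dotProduct, Fin.sum_univ_three]; rw [← h, det_fin_two]; ring) (by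
        simp [dotProduct, Fin.sum_univ_three]; ring) 1 (by simp)
    refine h1.trans (h2.trans (rowEquiv_change 0 {1, 2} (by simp) ?_ ?_))
    · intro k hk
      fin_cases k
      · exact absurd rfl hk
      · simp [Matrix.mul_apply, Fin.sum_univ_two]
      · simp [Matrix.mul_apply, Fin.sum_univ_two]
    · rw [Set.image_pair, Ideal.mem_span_pair]
      refine ⟨Λ 1 0, Λ 1 1, ?_⟩
      simp [det_fin_two]; ring

theorem rowEquiv_altMatrix_lower {a c : A} {P : Matrix (Fin 2) (Fin 2) A} (h : a * c - P.det = 1)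
    (Λ : Matrix (Fin 2) (Fin 2) A) :
    ∃ c' P', a * c' - P'.det = 1 ∧
      fromBlocks 1 0 Λ 1 * altMatrix a c P * (fromBlocks 1 0 Λ 1)ᵀ = altMatrix a c' P' ∧
      RowEquiv ![a, P 0 0, P 0 1] ![a, P' 0 0, P' 0 1] := by
  refine ⟨c + ((Λ * P) 0 1 - (Λ * P) 1 0) + a * Λ.det,
    P + a • (!![0, 1; -1, 0] * Λᵀ), ?_, ?_, ?_⟩
  · rw [det_fin_two] at h ⊢
    simp [det_fin_two, Matrix.mul_apply, vecMul, dotProduct, Fin.sum_univ_two]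
    linear_combination h
  · rw [altMatrix, altMatrix, fromBlocks_transpose, fromBlocks_multiply, fromBlocks_multiply]
    congr 1 <;> ext i j <;> fin_cases i <;> fin_cases j <;>
      simp [det_fin_two, Matrix.mul_apply, vecMul, dotProduct, Fin.sum_univ_two] <;> ring
  · refine rowEquiv_of_sub_mem_span {0} (by rintro _ rfl; rfl) fun k hk => ?_
    rw [Set.image_singleton, Ideal.mem_span_singleton]
    fin_cases k
    · exact absurd rfl hk
    · simp [vecMul, dotProduct, Fin.sum_univ_two]
    · simp [vecMul, dotProduct, Fin.sum_univ_two]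

theorem rowEquiv_altMatrix_diagonal {a c : A} {P T : Matrix (Fin 2) (Fin 2) A}
    (h : a * c - P.det = 1) (hT : T.det = 1) :
    RowEquiv ![a, P 0 0, P 0 1]
      ![a, (T * P * T.adjugateᵀ) 0 0, (T * P * T.adjugateᵀ) 0 1] := by
  have h1 : T * T.adjugate = 1 := by rw [Matrix.mul_adjugate, hT, one_smul]
  have h2 : T.adjugate * T = 1 := by rw [Matrix.adjugate_mul, hT, one_smul]
  obtain ⟨a₁, P₁, i₁, g₁, r₁⟩ := rowEquiv_altMatrix_upper h (-T.adjugate)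
  obtain ⟨c₂, P₂, i₂, g₂, r₂⟩ := rowEquiv_altMatrix_lower i₁ (T - 1)
  obtain ⟨a₃, P₃, i₃, g₃, r₃⟩ := rowEquiv_altMatrix_upper i₂ 1
  obtain ⟨c₄, P₄, i₄, g₄, r₄⟩ := rowEquiv_altMatrix_lower i₃ (T.adjugate - 1)
  have hg : fromBlocks 1 0 (T.adjugate - 1) 1 * (fromBlocks 1 1 0 1 * (fromBlocks 1 0 (T - 1) 1 *
      fromBlocks 1 (-T.adjugate) 0 1)) = fromBlocks T 0 0 T.adjugate := by
    simp only [fromBlocks_multiply]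
    simp [Matrix.sub_mul, h1, h2]
  have hfin : altMatrix a₃ c₄ P₄ = fromBlocks (T * (a • !![0, 1; -1, 0]) * Tᵀ) (T * P * T.adjugateᵀ)
      (T.adjugate * -Pᵀ * Tᵀ) (T.adjugate * (c • !![0, 1; -1, 0]) * T.adjugateᵀ) := by
    rw [← g₄, ← g₃, ← g₂, ← g₁]
    have : fromBlocks T 0 0 T.adjugate * altMatrix a c P * (fromBlocks T 0 0 T.adjugate)ᵀ =
        fromBlocks (T * (a • !![0, 1; -1, 0]) * Tᵀ) (T * P * T.adjugateᵀ)
      (T.adjugate * -Pᵀ * Tᵀ) (T.adjugate * (c • !![0, 1; -1, 0]) * T.adjugateᵀ) := by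
      rw [altMatrix, fromBlocks_transpose, fromBlocks_multiply, fromBlocks_multiply]
      simp
    rw [← this, ← hg]
    simp only [Matrix.transpose_mul, Matrix.mul_assoc]
  rw [altMatrix] at hfin
  obtain ⟨e1, e2, -, -⟩ := fromBlocks_inj.1 hfin
  have e3 : a₃ = a := by
    have := congrFun (congrFun e1 0) 1
    rw [det_fin_two] at hT
    simp [Matrix.mul_apply, Fin.sum_univ_two] at this
    rw [this]; linear_combination a * hT
  have := r₁.trans (r₂.trans (r₃.trans r₄))
  rwa [e2, e3] at this

theorem rowEquiv_mul_sq_three {a : Fin 3 → A} (ha : Unim a) {t : A}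
    (ht : ∃ t' s, t * t' + a 0 * s = 1) : RowEquiv a ![a 0, a 1, t ^ 2 * a 2] := by
  obtain ⟨c, hc⟩ := unim_iff.1 ha
  obtain ⟨t', s, h⟩ := ht
  have := rowEquiv_altMatrix_diagonal (a := a 0) (c := c 0) (P := !![a 1, a 2; c 2, -c 1])
    (T := !![t, -a 0; s, t']) (by
      rw [← hc]; simp [dotProduct, Fin.sum_univ_three]; ring) (by
      rw [← h]; simp)
  have h0 : a = ![a 0, (!![a 1, a 2; c 2, -c 1] : Matrix (Fin 2) (Fin 2) A) 0 0,
      (!![a 1, a 2; c 2, -c 1] : Matrix (Fin 2) (Fin 2) A) 0 1] := by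
    ext i; fin_cases i <;> rfl
  rw [← h0] at this
  refine this.trans ?_
  have s1 : RowEquiv ![a 0, (!![t, -a 0; s, t'] * !![a 1, a 2; c 2, -c 1] *
      (!![t, -a 0; s, t'] : Matrix (Fin 2) (Fin 2) A).adjugateᵀ) 0 0,
      (!![t, -a 0; s, t'] * !![a 1, a 2; c 2, -c 1] *
      (!![t, -a 0; s, t'] : Matrix (Fin 2) (Fin 2) A).adjugateᵀ) 0 1]
      ![a 0, a 1, t ^ 2 * a 2 - t * s * a 1] := by
    refine rowEquiv_of_sub_mem_span {0} (by rintro _ rfl; rfl) fun k hk => ?_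
    rw [Set.image_singleton, Ideal.mem_span_singleton]
    fin_cases k
    · exact absurd rfl hk
    · refine ⟨a 1 * s - t * a 2 + c 2 * t' - c 1 * a 0, ?_⟩
      simp [Matrix.mul_apply, Fin.sum_univ_two, adjugate_fin_two]
      linear_combination -a 1 * h
    · refine ⟨-(c 2 * s) - t * c 1, ?_⟩
      simp [Matrix.mul_apply, Fin.sum_univ_two, adjugate_fin_two]
      ring
  refine s1.trans (rowEquiv_transvection 1 2 (by decide) (t * s) ?_ ?_)
  · intro k hk
    fin_cases k
    · rfl
    · rfl
    · exact absurd rfl hk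
  · simp; ring

theorem rowEquiv_sumElim_of_map_mk {ι μ : Type*} [Fintype ι] [DecidableEq ι] [Fintype μ]
    [DecidableEq μ] {a b : ι → A} {τ : μ → A}
    (h : RowEquiv (Ideal.Quotient.mk (Ideal.span (Set.range τ)) ∘ a)
      (Ideal.Quotient.mk (Ideal.span (Set.range τ)) ∘ b)) :
    RowEquiv (Sum.elim a τ) (Sum.elim b τ) := by
  obtain ⟨ε, hε, h⟩ := h
  obtain ⟨δ, hδ, rfl⟩ := exists_lift_of_mem_elemMats Ideal.Quotient.mk_surjective hε
  refine (rowEquiv_sumElim_left ⟨δ, hδ, rfl⟩ τ).trans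
    (rowEquiv_of_sub_mem_span (Set.range Sum.inr) ?_ ?_)
  · rintro _ ⟨i, rfl⟩; rfl
  · rintro (i | i) hi
    · rw [← Set.range_comp, Sum.elim_comp_inr, ← Ideal.Quotient.eq]
      have := congrFun h i
      simp only [vecMul, dotProduct, Function.comp_apply, Matrix.map_apply, ← map_mul,
        ← map_sum] at this
      exact this.symm
    · exact absurd ⟨i, rfl⟩ hi

/-- Squares of units modulo the other entries can be moved into an entry. -/
theorem rowEquiv_mul_sq {μ : Type*} [Fintype μ] [DecidableEq μ] {a : Fin 3 → A} {τ : μ → A}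
    (ha : Unim (Sum.elim a τ)) {t t' s : A}
    (ht : t * t' + a 0 * s - 1 ∈ Ideal.span (Set.range τ)) :
    RowEquiv (Sum.elim a τ) (Sum.elim ![a 0, a 1, t ^ 2 * a 2] τ) := by
  refine rowEquiv_sumElim_of_map_mk ?_
  obtain ⟨q, hq⟩ : ∃ q, q = Ideal.Quotient.mk (Ideal.span (Set.range τ)) := ⟨_, rfl⟩
  rw [← hq]
  have h1 : Unim (q ∘ a) := by
    obtain ⟨u, hu⟩ := unim_iff.1 ha
    refine unim_iff.2 ⟨fun i => q (u (Sum.inl i)), ?_⟩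
    have h2 : ∑ i, q (τ i) * q (u (Sum.inr i)) = 0 := Finset.sum_eq_zero fun i _ => by
      have : q (τ i) = 0 := by
        rw [hq, Ideal.Quotient.eq_zero_iff_mem]
        exact Ideal.subset_span ⟨i, rfl⟩
      rw [this, zero_mul]
    have h3 := congrArg q hu
    simp only [dotProduct, Fintype.sum_sum_type, Sum.elim_inl, Sum.elim_inr, map_add, map_sum,
      map_mul, map_one, h2, add_zero] at h3
    exact h3
  have h2 : q t * q t' + (q ∘ a) 0 * q s = 1 := by
    rw [← Ideal.Quotient.eq, ← hq] at ht
    simpa using ht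
  have h3 : q ∘ ![a 0, a 1, t ^ 2 * a 2] = ![(q ∘ a) 0, (q ∘ a) 1, q t ^ 2 * (q ∘ a) 2] := by
    ext i; fin_cases i <;> simp
  rw [h3]
  exact rowEquiv_mul_sq_three h1 ⟨_, _, h2⟩

end Square

section Relations
variable {A : Type*} [CommRing A]

section Update
variable {ι : Type*} [Fintype ι] [DecidableEq ι] {o : ι} {v : ι → A}

theorem image_update_compl (o : ι) (v : ι → A) (q : A) :
    Function.update v o q '' {o}ᶜ = v '' {o}ᶜ :=
  Set.image_congr fun k hk => Function.update_of_ne (by simpa using hk) _ _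

theorem rowEquiv_update {q q' : A} (h : q' - q ∈ Ideal.span (v '' {o}ᶜ)) :
    RowEquiv (Function.update v o q) (Function.update v o q') :=
  rowEquiv_change o {o}ᶜ (by simp) (fun k hk => by simp [hk]) (by
    rw [image_update_compl]; simpa using h)

theorem unim_update_iff {q : A} :
    Unim (Function.update v o q) ↔ ∃ u, q * u - 1 ∈ Ideal.span (v '' {o}ᶜ) := by
  have : Set.range (Function.update v o q) = {q} ∪ v '' {o}ᶜ := by
    rw [← image_update_compl o v q, ← Set.image_univ, ← Set.union_compl_self {o}, Set.image_union]
    simp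
  rw [Unim, this, Ideal.span_union, Ideal.eq_top_iff_one, Submodule.mem_sup]
  constructor
  · rintro ⟨x, hx, y, hy, h⟩
    obtain ⟨u, rfl⟩ := Ideal.mem_span_singleton.1 hx
    exact ⟨u, by rw [← h, sub_add_cancel_left]; exact neg_mem hy⟩
  · rintro ⟨u, hu⟩
    exact ⟨q * u, Ideal.mul_mem_right _ _ (Ideal.mem_span_singleton_self q), _, neg_mem hu,
      by ring⟩

theorem rowEquiv_update_congr {w : ι → A} {q : A} (h : ∀ i, i ≠ o → w i - v i ∈ Ideal.span {q}) :
    RowEquiv (Function.update v o q) (Function.update w o q) := by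
  refine rowEquiv_of_sub_mem_span {o} (by rintro _ rfl; simp) fun i hi => ?_
  have hi : i ≠ o := by simpa using hi
  simpa [hi] using h i hi

end Update

variable {μ : Type*} [Fintype μ] [DecidableEq μ] {G : Type*} [CommGroup G]

theorem rowEquiv_mul_of_sq {q b₁ b₂ : A} {τ : μ → A} (ha : Unim (Sum.elim ![q, b₁, b₂] τ))
    {t t' s γ g β k : A} (ht : t * t' + q * s = 1) (hγ : γ - t ^ 2 = q * g)
    (hβ : γ * β - 1 = b₁ * k) :
    RowEquiv (Sum.elim ![q, b₁, b₂] τ) (Sum.elim ![q * γ, b₁, b₂] τ) := by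
  have s1 : RowEquiv (Sum.elim ![q, b₁, b₂] τ) (Sum.elim ![q, b₁, t ^ 2 * b₂] τ) := by
    have := rowEquiv_mul_sq (t := t) (t' := t') (s := s) ha (by simp [ht])
    simpa using this
  have s2 : RowEquiv ![q, b₁, t ^ 2 * b₂] ![q, b₁, γ * b₂] := by
    refine rowEquiv_transvection 0 2 (by decide) (g * b₂) ?_ ?_
    · intro i hi
      fin_cases i
      · rfl
      · rfl
      · exact absurd rfl hi
    · simp; linear_combination b₂ * hγ
  have s3 : RowEquiv ![q, b₁, γ * b₂] ![q * γ, b₁, γ * b₂ * β] := by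
    refine rowEquiv_scale 0 2 (by decide) {1} (by simp) (by simp) γ β ?_ ?_ rfl rfl
    · rw [hβ]
      simpa using Ideal.mul_mem_right _ _ (Ideal.mem_span_singleton_self b₁)
    · intro i h0 h2
      fin_cases i
      · exact absurd rfl h0
      · rfl
      · exact absurd rfl h2
  have s4 : RowEquiv ![q * γ, b₁, γ * b₂ * β] ![q * γ, b₁, b₂] := by
    refine rowEquiv_transvection 1 2 (by decide) (-(k * b₂)) ?_ ?_
    · intro i hi
      fin_cases i
      · rfl
      · rfl
      · exact absurd rfl hi
    · simp; linear_combination -b₂ * hβ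
  exact s1.trans (rowEquiv_sumElim_left (s2.trans (s3.trans s4)) τ)

theorem update_eq_sumElim (v : Fin 3 ⊕ μ → A) (q : A) :
    Function.update v (Sum.inl 0) q =
      Sum.elim ![q, v (Sum.inl 1), v (Sum.inl 2)] (v ∘ Sum.inr) := by
  ext (i | i)
  · fin_cases i <;> simp
  · simp

theorem IsSymbol.map_mul_of_add_eq_sq {φ : (Fin 3 ⊕ μ → A) → G} (hφ : IsSymbol φ (Sum.inl 0))
    (v : Fin 3 ⊕ μ → A) {q r e u w h : A} (huw : u * q + w * r = 1)
    (he : q + r - e ^ 2 = q * r * h)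
    (hq : Unim (Function.update v (Sum.inl 0) q)) (hr : Unim (Function.update v (Sum.inl 0) r))
    (hqr : Unim (Function.update v (Sum.inl 0) (q * r))) :
    φ (Function.update v (Sum.inl 0) (q * r)) =
      φ (Function.update v (Sum.inl 0) q) * φ (Function.update v (Sum.inl 0) r) := by
  -- the inverse of `e` modulo `q * r`
  obtain ⟨ε, hε⟩ : ∃ ε, ε = e * (u ^ 2 * q + w ^ 2 * r) := ⟨_, rfl⟩
  obtain ⟨m₁, hm₁⟩ : ∃ m, ε * e + q * r * m = 1 := by
    refine ⟨2 * u * w - (u ^ 2 + w ^ 2) + h * (u ^ 2 * q + w ^ 2 * r), ?_⟩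
    rw [hε]
    linear_combination -(u ^ 2 * q + w ^ 2 * r) * he + (u * q + w * r + 1) * huw
  obtain ⟨m₂, hm₂⟩ : ∃ m, ε ^ 2 * q + ε ^ 2 * r = 1 + q * r * m := by
    refine ⟨ε ^ 2 * h - m₁ * (1 + ε * e), ?_⟩
    linear_combination ε ^ 2 * he + (1 + ε * e) * hm₁
  obtain ⟨α, hα⟩ : ∃ α, α = ε ^ 2 - q * r * (m₂ * u) := ⟨_, rfl⟩
  obtain ⟨γ, hγ⟩ : ∃ γ, γ = ε ^ 2 - q * r * (m₂ * w) := ⟨_, rfl⟩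
  have hsum : q * α + r * γ = 1 := by
    rw [hα, hγ]; linear_combination hm₂ - q * r * m₂ * huw
  -- a product of units is a unit modulo `q * r`
  obtain ⟨m', g, hm⟩ : ∃ m' g, α * γ * m' + q * r * g = 1 := by
    have : IsCoprime (α * γ) (q * r) := by
      have h1 : IsCoprime ε (q * r) := ⟨e, m₁, by linear_combination hm₁⟩
      refine IsCoprime.mul_left ?_ ?_
      · rw [hα, sub_eq_add_neg, ← mul_neg]
        exact IsCoprime.add_mul_left_left h1.pow_left _
      · rw [hγ, sub_eq_add_neg, ← mul_neg]
        exact IsCoprime.add_mul_left_left h1.pow_left _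
    obtain ⟨a, b, hab⟩ := this
    exact ⟨a, b, by linear_combination hab⟩
  obtain ⟨v', hv'⟩ : ∃ v' : Fin 3 ⊕ μ → A, v' = fun i => v i * (α * γ * m') +
      if i = Sum.inl 1 then q * r * g else 0 := ⟨_, rfl⟩
  have hvv : ∀ i, v' i - v i ∈ Ideal.span {q * r} := fun i => by
    rw [Ideal.mem_span_singleton, hv']
    dsimp only
    split_ifs
    · exact ⟨g - g * v i, by linear_combination v i * hm⟩
    · exact ⟨- g * v i, by linear_combination v i * hm⟩
  have h1 : v' (Sum.inl 1) = 1 + α * γ * (m' * (v (Sum.inl 1) - 1)) := by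
    rw [hv']; simp; linear_combination hm
  have key : ∀ Q, Q ∣ q * r → Unim (Function.update v (Sum.inl 0) Q) → ∀ t t' s c b a,
      t * t' + Q * s = 1 → c - t ^ 2 = Q * a → c * b = α * γ →
      RowEquiv (Function.update v (Sum.inl 0) Q) (Function.update v' (Sum.inl 0) (Q * c)) := by
    intro Q hQ hQu t t' s c b a ht hc hb
    have s1 : RowEquiv (Function.update v (Sum.inl 0) Q) (Function.update v' (Sum.inl 0) Q) :=
      rowEquiv_update_congr fun i _ =>
        Ideal.span_singleton_le_span_singleton.2 hQ (hvv i)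
    have hu := s1.unim hQu
    refine s1.trans ?_
    rw [update_eq_sumElim] at hu
    rw [update_eq_sumElim, update_eq_sumElim]
    refine rowEquiv_mul_of_sq hu ht hc (β := -(b * (m' * (v (Sum.inl 1) - 1)))) (k := -1) ?_
    rw [h1]; linear_combination -(m' * (v (Sum.inl 1) - 1)) * hb
  have k1 := key q ⟨r, rfl⟩ hq ε e (r * m₁) α γ (-(r * (m₂ * u))) (by linear_combination hm₁)
    (by rw [hα]; ring) rfl
  have k2 := key r ⟨q, mul_comm _ _⟩ hr ε e (q * m₁) γ α (-(q * (m₂ * w)))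
    (by linear_combination hm₁) (by rw [hγ]; ring) (mul_comm _ _)
  have k3 := key (q * r) dvd_rfl hqr (ε ^ 2) (e ^ 2) (m₁ * (1 + ε * e)) (α * γ) 1
    (-(ε ^ 2 * (m₂ * u)) - ε ^ 2 * (m₂ * w) + q * r * (m₂ * u) * (m₂ * w))
    (by linear_combination (1 + ε * e) * hm₁) (by rw [hα, hγ]; ring) (mul_one _)
  have := hφ.map_mul _ _ v' hsum (k1.unim hq) (k2.unim hr)
  rw [hφ.map_eq hqr k3, hφ.map_eq hq k1, hφ.map_eq hr k2, ← this]
  congr 2; ring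

end Relations

section Inverse
variable {A : Type*} [CommRing A] {μ : Type*} [Fintype μ] [DecidableEq μ] {G : Type*} [CommGroup G]
  {φ : (Fin 3 ⊕ μ → A) → G}

theorem IsSymbol.map_eq_one_of_unit {ι : Type*} [Fintype ι] [DecidableEq ι] {ψ : (ι → A) → G}
    {o l : ι} (hψ : IsSymbol ψ o) (hl : l ≠ o) (v : ι → A) {q p : A} (hqp : q * p = 1) :
    ψ (Function.update v o q) = 1 := by
  have hspan : Ideal.span {q} = ⊤ := by
    rw [Ideal.span_singleton_eq_top]; exact .of_mul_eq_one p hqp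
  have h0 : ∀ x : A, Unim (Function.update (Pi.single l 1 : ι → A) o x) := fun x => by
    refine unim_iff.2 ⟨Pi.single l 1, ?_⟩
    simp [hl]
  have h1 : Unim (Function.update v o q) := unim_update_iff.2 ⟨p, by simp [hqp]⟩
  have r1 : RowEquiv (Function.update v o q) (Function.update (Pi.single l 1 : ι → A) o q) :=
    rowEquiv_update_congr fun i _ => by rw [hspan]; trivial
  have r2 : RowEquiv (Function.update (Pi.single l 1 : ι → A) o q)
      (Function.update (Pi.single l 1 : ι → A) o 1) := by
    refine rowEquiv_update ?_
    have : (1 : A) ∈ Ideal.span ((Pi.single l 1 : ι → A) '' {o}ᶜ) :=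
      Ideal.subset_span ⟨l, by simpa using hl, by simp⟩
    rw [(Ideal.eq_top_iff_one _).2 this]; trivial
  have := hψ.map_mul 1 0 (Pi.single l 1) (add_zero 1) (h0 1) (h0 0)
  rw [mul_zero, right_eq_mul] at this
  rw [hψ.map_eq h1 (r1.trans r2), this]

theorem unim_update_of_sub_mem {ι : Type*} [Fintype ι] [DecidableEq ι] {o : ι} {v : ι → A}
    {q q' : A} (h : q' - q ∈ Ideal.span (v '' {o}ᶜ)) (hq : Unim (Function.update v o q)) :
    Unim (Function.update v o q') :=
  (rowEquiv_update h).unim hq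

theorem unim_update_mul {ι : Type*} [Fintype ι] [DecidableEq ι] {o : ι} {v : ι → A}
    {q q' : A} (hq : Unim (Function.update v o q)) (hq' : Unim (Function.update v o q')) :
    Unim (Function.update v o (q * q')) := by
  obtain ⟨u, hu⟩ := unim_update_iff.1 hq
  obtain ⟨u', hu'⟩ := unim_update_iff.1 hq'
  refine unim_update_iff.2 ⟨u * u', ?_⟩
  have : q * q' * (u * u') - 1 = q' * u' * (q * u - 1) + (q' * u' - 1) := by ring
  rw [this]
  exact add_mem (Ideal.mul_mem_left _ _ hu) hu'

theorem IsSymbol.map_update_eq {ι : Type*} [Fintype ι] [DecidableEq ι] {ψ : (ι → A) → G}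
    {o o' : ι} (hψ : IsSymbol ψ o') {v : ι → A} {q q' : A}
    (h : q' - q ∈ Ideal.span (v '' {o}ᶜ)) (hq : Unim (Function.update v o q)) :
    ψ (Function.update v o q') = ψ (Function.update v o q) :=
  (hψ.map_eq hq (rowEquiv_update h)).symm

theorem IsSymbol.map_mul_sq (hφ : IsSymbol φ (Sum.inl 0)) (v : Fin 3 ⊕ μ → A) {q p : A}
    (hq : Unim (Function.update v (Sum.inl 0) q))
    (hp : Unim (Function.update v (Sum.inl 0) (p ^ 2))) :
    φ (Function.update v (Sum.inl 0) (q * p ^ 2)) =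
      φ (Function.update v (Sum.inl 0) q) * φ (Function.update v (Sum.inl 0) (p ^ 2)) := by
  obtain ⟨x, hx⟩ := unim_update_iff.1 hp
  obtain ⟨u, hu⟩ : ∃ u, u = x * (1 - q) := ⟨_, rfl⟩
  have h1 : 1 - p ^ 2 * u - q ∈ Ideal.span (v '' {Sum.inl 0}ᶜ) := by
    have : 1 - p ^ 2 * u - q = (q - 1) * (p ^ 2 * x - 1) := by rw [hu]; ring
    rw [this]; exact Ideal.mul_mem_left _ _ hx
  have h2 : (1 - p ^ 2 * u) * p ^ 2 - q * p ^ 2 ∈ Ideal.span (v '' {Sum.inl 0}ᶜ) := by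
    rw [← sub_mul]; exact Ideal.mul_mem_right _ _ h1
  have hq' := unim_update_of_sub_mem h1 hq
  have := hφ.map_mul_of_add_eq_sq v (q := 1 - p ^ 2 * u) (r := p ^ 2) (u := 1) (w := u)
    (e := p ^ 3 * u + (1 - p ^ 2 * u)) (h := u + (1 + p ^ 2 * u) - 2 * p * u)
    (by ring) (by ring) hq' hp (unim_update_mul hq' hp)
  rw [← hφ.map_update_eq h1 hq, ← this, ← hφ.map_update_eq h2 (unim_update_mul hq hp)]

theorem unim_update_neg {ι : Type*} [Fintype ι] [DecidableEq ι] {o : ι} {v : ι → A}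
    {q : A} (hq : Unim (Function.update v o q)) : Unim (Function.update v o (-q)) := by
  obtain ⟨u, hu⟩ := unim_update_iff.1 hq
  exact unim_update_iff.2 ⟨-u, by simpa using hu⟩

theorem IsSymbol.map_mul_neg (hφ : IsSymbol φ (Sum.inl 0)) (v : Fin 3 ⊕ μ → A) {q : A}
    (hq : Unim (Function.update v (Sum.inl 0) q)) :
    φ (Function.update v (Sum.inl 0) (-q ^ 2)) =
      φ (Function.update v (Sum.inl 0) q) * φ (Function.update v (Sum.inl 0) (-q)) := by
  obtain ⟨u, hu⟩ := unim_update_iff.1 hq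
  have he : 1 - q * u ∈ Ideal.span (v '' {Sum.inl 0}ᶜ) := by
    have := neg_mem hu
    rwa [neg_sub] at this
  have h1 : (1 - q * u) ^ 2 - q - -q ∈ Ideal.span (v '' {Sum.inl 0}ᶜ) := by
    have : (1 - q * u) ^ 2 - q - -q = (1 - q * u) * (1 - q * u) := by ring
    rw [this]; exact Ideal.mul_mem_left _ _ he
  have h2 : q * ((1 - q * u) ^ 2 - q) - -q ^ 2 ∈ Ideal.span (v '' {Sum.inl 0}ᶜ) := by
    have : q * ((1 - q * u) ^ 2 - q) - -q ^ 2 = q * ((1 - q * u) ^ 2 - q - -q) := by ring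
    rw [this]; exact Ideal.mul_mem_left _ _ h1
  have hn := unim_update_neg hq
  have hr := unim_update_of_sub_mem h1 hn
  have hq2 : Unim (Function.update v (Sum.inl 0) (-q ^ 2)) := by
    have := unim_update_mul hq hn
    rwa [mul_neg, ← pow_two] at this
  have := hφ.map_mul_of_add_eq_sq v (q := q) (r := (1 - q * u) ^ 2 - q) (u := 1 + 2 * u - q * u ^ 2)
    (w := 1) (e := 1 - q * u) (h := 0) (by ring) (by ring) hq hr (unim_update_mul hq hr)
  rw [← hφ.map_update_eq h1 hn, ← this, ← hφ.map_update_eq h2 hq2]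

/-- The inverse of a class is a product of the class of a sign change and the class of a row
containing a square. -/
theorem IsSymbol.exists_map_inv (hφ : IsSymbol φ (Sum.inl 0)) {v : Fin 3 ⊕ μ → A} (hv : Unim v) :
    ∃ p, Unim (Function.update v (Sum.inl 0) (p ^ 2)) ∧
      (φ v)⁻¹ = φ (Function.update v (Sum.inl 0) (-v (Sum.inl 0))) *
        φ (Function.update v (Sum.inl 0) (p ^ 2)) := by
  obtain ⟨q, hq⟩ : ∃ q, q = v (Sum.inl 0) := ⟨_, rfl⟩
  have hvq : Function.update v (Sum.inl 0) q = v := by rw [hq, Function.update_eq_self]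
  have hu : Unim (Function.update v (Sum.inl 0) q) := by rwa [hvq]
  obtain ⟨p, hp⟩ := unim_update_iff.1 hu
  have hp1 : Unim (Function.update v (Sum.inl 0) p) := unim_update_iff.2 ⟨q, by rwa [mul_comm]⟩
  have hp2 : Unim (Function.update v (Sum.inl 0) (p ^ 2)) := by
    rw [pow_two]; exact unim_update_mul hp1 hp1
  have hq2 : Unim (Function.update v (Sum.inl 0) (-q ^ 2)) := by
    refine unim_update_neg ?_
    rw [pow_two]; exact unim_update_mul hu hu
  refine ⟨p, hp2, ?_⟩
  have h1 : -q ^ 2 * p ^ 2 - -1 ∈ Ideal.span (v '' {Sum.inl 0}ᶜ) := by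
    have : -q ^ 2 * p ^ 2 - -1 = -(q * p + 1) * (q * p - 1) := by ring
    rw [this]; exact Ideal.mul_mem_left _ _ hp
  have h2 : φ (Function.update v (Sum.inl 0) (-1)) = 1 :=
    hφ.map_eq_one_of_unit (l := Sum.inl 1) (by simp) v (p := -1) (by ring)
  have h3 := hφ.map_mul_sq v hq2 hp2
  have h4 : Unim (Function.update v (Sum.inl 0) (-1 : A)) :=
    unim_update_iff.2 ⟨-1, by simp⟩
  rw [hφ.map_update_eq h1 h4, h2, hφ.map_mul_neg v hu, hvq] at h3
  rw [← hq, inv_eq_iff_mul_eq_one, ← mul_assoc, h3]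

end Inverse

section Lift
variable {A : Type*} [CommRing A] {ι μ : Type*} [Fintype ι] [DecidableEq ι] [Fintype μ]
  [DecidableEq μ]

theorem exists_right_inverse_of_orthogonal {v z : ι → A} (hv : Unim v) (hz : Unim z)
    (h : v ⬝ᵥ z = 0) :
    ∃ M : Matrix (Fin 2) ι A, (∃ N : Matrix ι (Fin 2) A, M * N = 1) ∧ M 0 = v := by
  obtain ⟨u, hu⟩ := unim_iff.1 hv
  obtain ⟨w, hw⟩ := unim_iff.1 hz
  refine ⟨of ![v, w - (w ⬝ᵥ u) • v], ⟨(of ![u, z])ᵀ, ?_⟩, rfl⟩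
  rw [dotProduct_comm] at hw
  ext i j
  rw [mul_apply']
  fin_cases i <;> fin_cases j
  · exact hu
  · exact h
  · change (w - (w ⬝ᵥ u) • v) ⬝ᵥ u = 0
    rw [sub_dotProduct, smul_dotProduct, hu, smul_eq_mul, mul_one, sub_self]
  · change (w - (w ⬝ᵥ u) • v) ⬝ᵥ z = 1
    rw [sub_dotProduct, smul_dotProduct, h, hw, smul_zero, sub_zero]

theorem exists_orthogonal_of_even_card (h : Even (Fintype.card μ)) (τ : μ → A) :
    ∃ σ : μ → A, τ ⬝ᵥ σ = 0 ∧ Ideal.span (Set.range τ) ≤ Ideal.span (Set.range σ) := by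
  obtain ⟨m, hm⟩ := h
  have e : μ ≃ Fin m × Fin 2 := Fintype.equivOfCardEq (by simp [hm, mul_two])
  refine ⟨fun i =>
      (fun x : Fin m × Fin 2 => ![-τ (e.symm (x.1, 1)), τ (e.symm (x.1, 0))] x.2) (e i),
    ?_, ?_⟩
  · rw [dotProduct, ← e.symm.sum_comp, Fintype.sum_prod_type]
    refine Finset.sum_eq_zero fun i _ => ?_
    simp only [Fin.sum_univ_two, Equiv.apply_symm_apply, cons_val_zero, cons_val_one]
    ring
  · rw [Ideal.span_le]
    rintro _ ⟨i, rfl⟩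
    obtain ⟨⟨k, j⟩, rfl⟩ := e.symm.surjective i
    fin_cases j
    · exact Ideal.subset_span ⟨e.symm (k, 1), by simp⟩
    · rw [SetLike.mem_coe, ← neg_mem_iff]
      exact Ideal.subset_span ⟨e.symm (k, 0), by simp⟩

theorem exists_right_inverse_of_sq (h : Even (Fintype.card μ)) {q y z : A} {τ : μ → A}
    (hv : Unim (Sum.elim ![q ^ 2, y, z] τ)) :
    ∃ M : Matrix (Fin 2) (Fin 3 ⊕ μ) A, (∃ N : Matrix (Fin 3 ⊕ μ) (Fin 2) A, M * N = 1) ∧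
      M 0 = Sum.elim ![q ^ 2, y, z] τ := by
  obtain ⟨σ, hσ, hτσ⟩ := exists_orthogonal_of_even_card h τ
  obtain ⟨u, hu⟩ := unim_iff.1 hv
  obtain ⟨p, b, t, hp⟩ : ∃ p b t, q ^ 2 * p + (b * z - t * y) - 1 ∈ Ideal.span (Set.range τ) := by
    refine ⟨u (Sum.inl 0), u (Sum.inl 2), -u (Sum.inl 1), ?_⟩
    have : q ^ 2 * u (Sum.inl 0) + (u (Sum.inl 2) * z - -u (Sum.inl 1) * y) - 1 =
        -(τ ⬝ᵥ (u ∘ Sum.inr)) := by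
      rw [← hu]
      simp [dotProduct, Fin.sum_univ_three]
      ring
    rw [this]
    exact neg_mem (sum_mem fun i _ => Ideal.mul_mem_right _ _ (Ideal.subset_span ⟨i, rfl⟩))
  obtain ⟨c, hc⟩ : ∃ c, c = p * (1 + (b * z - t * y)) := ⟨_, rfl⟩
  obtain ⟨ζ, hζ⟩ : ∃ ζ, ζ = ![q ^ 2, y, z] ⨯₃ ![-y, b ^ 2 + c * y ^ 2, b * t + c * y * z - q * c] :=
    ⟨_, rfl⟩
  obtain ⟨D, hD⟩ : ∃ D, D = ![-z, b * t + c * y * z + q * c, t ^ 2 + c * z ^ 2] ⬝ᵥ ζ := ⟨_, rfl⟩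
  have h1 : ![q ^ 2, y, z] ⬝ᵥ ζ = 0 := by rw [hζ, dot_self_cross]
  have h2 : D - 1 ∈ Ideal.span (Set.range τ) := by
    obtain ⟨g, hg⟩ : ∃ g, g = q ^ 2 * p + (b * z - t * y) - 1 := ⟨_, rfl⟩
    rw [← hg] at hp
    obtain ⟨N, hN⟩ : ∃ N, N = b * z - t * y := ⟨_, rfl⟩
    have e1 : D = q ^ 2 * c * N ^ 2 + q ^ 4 * c ^ 2 + N ^ 2 := by
      rw [hD, hζ, cross_apply, hN]
      simp [dotProduct, Fin.sum_univ_three]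
      ring
    have e2 : q ^ 2 * c = (g + 1 - N) * (1 + N) := by rw [hc, hg, hN]; ring
    have : D - 1 = ((1 + N) * N ^ 2 + 2 * (1 - N ^ 2) * (1 + N) + g * (1 + N) ^ 2) * g := by
      rw [e1, show q ^ 4 * c ^ 2 = (q ^ 2 * c) ^ 2 by ring, e2]; ring
    rw [this]
    exact Ideal.mul_mem_left _ _ hp
  refine exists_right_inverse_of_orthogonal (z := Sum.elim (D • ζ) σ) hv ?_ ?_
  · have h3 : D ^ 2 ∈ Ideal.span (Set.range (Sum.elim (D • ζ) σ)) := by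
      have : D ^ 2 = ∑ i, ![-z, b * t + c * y * z + q * c, t ^ 2 + c * z ^ 2] i * (D • ζ) i := by
        rw [pow_two, ← smul_eq_mul D D]
        nth_rw 2 [hD]
        rw [← dotProduct_smul]; rfl
      rw [this]
      exact sum_mem fun i _ => Ideal.mul_mem_left _ _ (Ideal.subset_span ⟨Sum.inl i, rfl⟩)
    have h4 : (D + 1) * (D - 1) ∈ Ideal.span (Set.range (Sum.elim (D • ζ) σ)) :=
      Ideal.mul_mem_left _ _ (Ideal.span_mono
        (by rintro _ ⟨i, rfl⟩; exact ⟨Sum.inr i, rfl⟩) (hτσ h2))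
    rw [Unim, Ideal.eq_top_iff_one]
    have := sub_mem h3 h4
    rwa [show D ^ 2 - (D + 1) * (D - 1) = 1 by ring] at this
  · rw [dotProduct, Fintype.sum_sum_type]
    change ![q ^ 2, y, z] ⬝ᵥ (D • ζ) + τ ⬝ᵥ σ = 0
    rw [dotProduct_smul, h1, hσ, smul_zero, add_zero]

end Lift

section Image
variable {A : Type*} [CommRing A] {ι κ : Type*} [Fintype ι] [DecidableEq ι] [Fintype κ]
  [DecidableEq κ] {G : Type*} [CommGroup G]

theorem unim_comp_equiv {v : ι → A} (e : κ ≃ ι) : Unim (v ∘ e) ↔ Unim v := by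
  rw [Unim, Unim, e.surjective.range_comp]

theorem IsSymbol.comp_equiv {φ : (ι → A) → G} {o : ι} (hφ : IsSymbol φ o) (e : ι ≃ κ) :
    IsSymbol (fun v : κ → A => φ (v ∘ e)) (e o) where
  map_eq hv h := hφ.map_eq ((unim_comp_equiv e).2 hv) (h.comp e)
  map_mul x y a h hx hy := by
    have key (q : A) : Function.update a (e o) q ∘ e = Function.update (a ∘ e) o q := by
      rw [Function.update_comp_equiv, e.symm_apply_apply]
    rw [← unim_comp_equiv e, key] at hx hy
    simp only [key]
    exact hφ.map_mul x y _ h hx hy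

/-- The rows which can be completed to a right invertible matrix with two rows. -/
def IsFirstRow (v : ι → A) : Prop :=
  ∃ M : Matrix (Fin 2) ι A, (∃ N : Matrix ι (Fin 2) A, M * N = 1) ∧ M 0 = v

theorem IsFirstRow.unim {v : ι → A} (h : IsFirstRow v) : Unim v := by
  obtain ⟨M, hM, rfl⟩ := h
  exact unim_of_exists_right_inverse hM 0

theorem IsFirstRow.comp {v : ι → A} (h : IsFirstRow v) (e : κ ≃ ι) : IsFirstRow (v ∘ e) := by
  obtain ⟨M, ⟨N, hN⟩, rfl⟩ := h
  refine ⟨M.submatrix id e, ⟨N.submatrix e id, ?_⟩, rfl⟩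
  rw [submatrix_mul_equiv, hN, submatrix_one _ Function.injective_id]

theorem IsFirstRow.update_neg {v : ι → A} (h : IsFirstRow v) (o : ι) :
    IsFirstRow (Function.update v o (-v o)) := by
  obtain ⟨M, ⟨N, hN⟩, rfl⟩ := h
  let D : Matrix ι ι A := diagonal (Function.update 1 o (-1))
  have hD : D * D = 1 := by
    rw [diagonal_mul_diagonal, ← diagonal_one]
    congr 1
    ext i
    by_cases hi : i = o
    · subst hi; simp
    · simp [hi]
  refine ⟨M * D, ⟨D * N, ?_⟩, ?_⟩
  · rw [Matrix.mul_assoc, ← Matrix.mul_assoc D, hD, Matrix.one_mul, hN]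
  · ext i
    rw [mul_diagonal]
    by_cases hi : i = o
    · subst hi; simp
    · simp [hi]

theorem isFirstRow_of_even_card (h : Even (Fintype.card ι)) {v : ι → A} (hv : Unim v) :
    IsFirstRow v := by
  obtain ⟨z, hz, hle⟩ := exists_orthogonal_of_even_card h v
  refine exists_right_inverse_of_orthogonal hv (top_le_iff.1 ?_) hz
  rw [Unim] at hv
  rwa [hv] at hle

theorem isFirstRow_single {o l : ι} (h : o ≠ l) : IsFirstRow (Pi.single o 1 : ι → A) :=
  exists_right_inverse_of_orthogonal (z := Pi.single l 1)
    (unim_iff.2 ⟨Pi.single o 1, by simp⟩) (unim_iff.2 ⟨Pi.single l 1, by simp⟩) (by simp [h])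

theorem IsSymbol.exists_isFirstRow_mul [IsNoetherianRing A] {d : ℕ} (hd : ringKrullDim A ≤ d)
    (hdn : d + 5 ≤ 2 * Fintype.card ι) (h5 : 5 ≤ Fintype.card ι) {φ : (ι → A) → G} {o : ι}
    (hφ : IsSymbol φ o) {v w : ι → A} (hv : IsFirstRow v) (hw : IsFirstRow w) :
    ∃ p, IsFirstRow p ∧ φ p = φ v * φ w := by
  obtain ⟨k, hk⟩ := Nat.exists_eq_add_of_le h5
  obtain ⟨e', -⟩ : ∃ e' : ι ≃ Fin 2 ⊕ (Fin 1 ⊕ (Fin 2 ⊕ Fin k)), True :=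
    ⟨Fintype.equivOfCardEq (by simp [hk]; ring), trivial⟩
  obtain ⟨e, he⟩ : ∃ e : ι ≃ Fin 2 ⊕ (Fin 1 ⊕ (Fin 2 ⊕ Fin k)), e o = Sum.inr (Sum.inl 0) :=
    ⟨e'.trans (Equiv.swap (e' o) (Sum.inr (Sum.inl 0))), by simp⟩
  have hψ := hφ.comp_equiv e
  rw [he] at hψ
  obtain ⟨M, hM, hMv⟩ := hv.comp e.symm
  obtain ⟨N, hN, hNw⟩ := hw.comp e.symm
  obtain ⟨P, hP, h⟩ := hψ.exists_map_mul hd (by simp; omega) M N hM hN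
  refine ⟨P 0 ∘ e, IsFirstRow.comp ⟨P, hP, rfl⟩ e, ?_⟩
  simpa [hMv, hNw, Function.comp_assoc] using h

theorem IsSymbol.exists_isFirstRow_inv [IsNoetherianRing A] {d : ℕ} (hd : ringKrullDim A ≤ d)
    (hdn : d + 5 ≤ 2 * Fintype.card ι) (h5 : 5 ≤ Fintype.card ι) (hodd : Odd (Fintype.card ι))
    {φ : (ι → A) → G} {o : ι} (hφ : IsSymbol φ o) {v : ι → A} (hv : IsFirstRow v) :
    ∃ p, IsFirstRow p ∧ φ p = (φ v)⁻¹ := by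
  obtain ⟨k, hk⟩ := Nat.exists_eq_add_of_le (show 3 ≤ Fintype.card ι by omega)
  obtain ⟨e', -⟩ : ∃ e' : ι ≃ Fin 3 ⊕ Fin k, True :=
    ⟨Fintype.equivOfCardEq (by simp [hk]), trivial⟩
  obtain ⟨e, he⟩ : ∃ e : ι ≃ Fin 3 ⊕ Fin k, e o = Sum.inl 0 :=
    ⟨e'.trans (Equiv.swap (e' o) (Sum.inl 0)), by simp⟩
  have hψ := hφ.comp_equiv e
  rw [he] at hψ
  have hv' := hv.comp e.symm
  obtain ⟨p, hp, h⟩ := hψ.exists_map_inv hv'.unim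
  have hk' : Even (Fintype.card (Fin k)) := by
    rw [Fintype.card_fin]; rw [hk] at hodd
    exact (Nat.odd_add.1 hodd).1 (by decide)
  have hsq : IsFirstRow (Function.update (v ∘ e.symm) (Sum.inl 0) (p ^ 2)) := by
    have : Function.update (v ∘ e.symm) (Sum.inl 0) (p ^ 2) =
        Sum.elim ![p ^ 2, (v ∘ e.symm) (Sum.inl 1), (v ∘ e.symm) (Sum.inl 2)]
          ((v ∘ e.symm) ∘ Sum.inr) := by
      ext i
      rcases i with i | i
      · fin_cases i <;> simp
      · simp
    rw [this] at hp ⊢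
    exact exists_right_inverse_of_sq hk' hp
  obtain ⟨P, hP, hPφ⟩ := hφ.exists_isFirstRow_mul hd hdn h5
    ((hv'.update_neg (Sum.inl 0)).comp e) (hsq.comp e)
  refine ⟨P, hP, ?_⟩
  rw [hPφ]
  simpa [Function.comp_assoc] using h.symm

end Image

end ElemRows

/-- let `A` be a commutative noetherian ring of Krull dimension
`d ≤ 2n - 5` (with `2 ≤ d`), and let `wms` realize van der Kallen's abelian group
structure on `Um_n(A)/E_n(A)` (a bijection of the orbit set with `G`, satisfying MS1
and MS3).  Then the image of `Row₁ : Um_{2,n}(A)/E_n(A) → Um_n(A)/E_n(A)`, i.e. the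
set of classes of first rows of unimodular `2 × n` matrices, is a subgroup of `G`. -/
theorem stmt19 {A G : Type*} [CommRing A] [IsNoetherianRing A] [CommGroup G] {d n : ℕ}
    (hd : ringKrullDim A ≤ d) (hd2 : 2 ≤ d) (hdn : d + 5 ≤ 2 * n)
    (wms : (Fin n → A) → G)
    (hsurj : ∀ g : G, ∃ v : Fin n → A, Unim v ∧ wms v = g)
    (horbit : ∀ v w : Fin n → A, Unim v → Unim w →
      (wms v = wms w ↔ ∃ ε ∈ ElemMats (Fin n) A, Matrix.vecMul v ε = w))
    (hMS1 : ∀ v : Fin n → A, Unim v → ∀ ε ∈ ElemMats (Fin n) A,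
      wms (Matrix.vecMul v ε) = wms v)
    (hMS3 : ∀ (x y : A) (a : Fin n → A), x + y = 1 →
      Unim (Function.update a (⟨0, by omega⟩ : Fin n) x) →
      Unim (Function.update a (⟨0, by omega⟩ : Fin n) y) →
      wms (Function.update a (⟨0, by omega⟩ : Fin n) (x * y)) =
        wms (Function.update a (⟨0, by omega⟩ : Fin n) x) *
        wms (Function.update a (⟨0, by omega⟩ : Fin n) y)) :
    ∃ H : Subgroup G, (H : Set G) =
      {g : G | ∃ M : Matrix (Fin 2) (Fin n) A,
        (∃ N : Matrix (Fin n) (Fin 2) A, M * N = 1) ∧ wms (M 0) = g} := by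
  have hrow (g : G) : (∃ M : Matrix (Fin 2) (Fin n) A,
      (∃ N : Matrix (Fin n) (Fin 2) A, M * N = 1) ∧ wms (M 0) = g) ↔
      ∃ v, ElemRows.IsFirstRow v ∧ wms v = g :=
    ⟨fun ⟨M, hM, h⟩ => ⟨_, ⟨M, hM, rfl⟩, h⟩, fun ⟨_, ⟨M, hM, hMv⟩, h⟩ => ⟨M, hM, hMv ▸ h⟩⟩
  simp only [hrow]
  rcases n.even_or_odd with hn | hn
  · refine ⟨⊤, ?_⟩
    ext g
    obtain ⟨v, hv, hvg⟩ := hsurj g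
    simpa using ⟨v, ElemRows.isFirstRow_of_even_card (by simpa using hn) hv, hvg⟩
  · have h5 : 5 ≤ Fintype.card (Fin n) := by
      obtain ⟨m, rfl⟩ := hn
      rw [Fintype.card_fin]
      omega
    have hdn' : d + 5 ≤ 2 * Fintype.card (Fin n) := by rwa [Fintype.card_fin]
    have hφ : ElemRows.IsSymbol wms (⟨0, by omega⟩ : Fin n) :=
      ⟨fun hv ⟨ε, hε, h⟩ => h ▸ (hMS1 _ hv ε hε).symm, hMS3⟩
    refine ⟨{ carrier := {g | ∃ v, ElemRows.IsFirstRow v ∧ wms v = g}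
              mul_mem' := ?_, one_mem' := ?_, inv_mem' := ?_ }, rfl⟩
    · rintro _ _ ⟨v, hv, rfl⟩ ⟨w, hw, rfl⟩
      exact hφ.exists_isFirstRow_mul hd hdn' h5 hv hw
    · have hl : (⟨1, by omega⟩ : Fin n) ≠ ⟨0, by omega⟩ := by simp
      exact ⟨_, ElemRows.isFirstRow_single hl.symm,
        hφ.map_eq_one_of_unit hl 0 (mul_one 1)⟩
    · rintro _ ⟨v, hv, rfl⟩
      exact hφ.exists_isFirstRow_inv hd hdn' h5 (by simpa using hn) hv
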